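/- There exists an absolute constant C > 0 such that for every ε ∈ (0, 1] the following holds. Let H be a tame histogram, i.e. the region bounded below by a horizontal segment pq and above by a tame path L from p to q lying on or above the line through p and q, and let S ⊂ ∂H be a finite set of points on the boundary of H. Then there exists a geometric graph E of total weight at most C · ε^{−1/2} · hper(H), such that for all a, b ∈ S, if the segment ab is contained in H and |x(a) − x(b)| ≤ ε^{1/2}·|y(a) − y(b)| (i.e. the slope of ab is at least ε^{−1/2} in absolute value, or ab is vertical), then there is an ab-path P in E with weight ‖P‖ ≤ (1 + C·ε)·‖a − b‖. -/

import Mathlib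

open scoped Classical

noncomputable section

/-- The Euclidean plane. -/
abbrev Plane : Type := EuclideanSpace ℝ (Fin 2)

/-- The point `(x, y) ∈ ℝ²`. -/
def pt (x y : ℝ) : Plane := (EuclideanSpace.equiv (Fin 2) ℝ).symm ![x, y]

/-- The union of the segments of a geometric graph. -/
def segUnion (E : Finset (Plane × Plane)) : Set Plane :=
  ⋃ e ∈ E, segment ℝ e.1 e.2

/-- The total weight of a geometric graph: the sum of the Euclidean lengths of its
segments. -/
def gweight (E : Finset (Plane × Plane)) : ℝ :=
  ∑ e ∈ E, ‖e.1 - e.2‖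

/-- `HasPath E s t w` : there is a polygonal path from `s` to `t`, each of whose edges is
contained in the union of the segments of `E`, of weight at most `w`. -/
def HasPath (E : Finset (Plane × Plane)) (s t : Plane) (w : ℝ) : Prop :=
  ∃ (m : ℕ) (v : ℕ → Plane), v 0 = s ∧ v m = t ∧
    (∀ i < m, segment ℝ (v i) (v (i + 1)) ⊆ segUnion E) ∧
    ∑ i ∈ Finset.range m, ‖v (i + 1) - v i‖ ≤ w

/-- A rectilinear path: every edge is horizontal or vertical. -/
def IsRectilinear (n : ℕ) (u : ℕ → Plane) : Prop :=
  ∀ i < n, u i 0 = u (i + 1) 0 ∨ u i 1 = u (i + 1) 1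

/-- The set of points of the polygonal path with vertices `u 0, …, u n`. -/
def pathSet (n : ℕ) (u : ℕ → Plane) : Set Plane :=
  ⋃ i ∈ Finset.range n, segment ℝ (u i) (u (i + 1))

/-- The edges of the polygonal path with vertices `u 0, …, u n`, as a geometric graph. -/
def pathEdges (n : ℕ) (u : ℕ → Plane) : Finset (Plane × Plane) :=
  (Finset.range n).image fun i => (u i, u (i + 1))

/-- The region below an `x`-monotone path with point set `L` : points `p` that lie
vertically below some point of `L` and not below the lowest point of `L`. -/
def belowRegion (L : Set Plane) : Set Plane :=
  {p | (∃ q ∈ L, q 0 = p 0 ∧ p 1 ≤ q 1) ∧ (∃ q ∈ L, q 1 ≤ p 1)}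

/-- The length of the subpath of the path `u 0, …, u n` from a point `a` on the `i`-th
edge to a point `b` on the `j`-th edge (for `i ≤ j`). -/
def subLen (u : ℕ → Plane) (i j : ℕ) (a b : Plane) : ℝ :=
  if i = j then ‖b - a‖
  else ‖u (i + 1) - a‖ + (∑ k ∈ Finset.Ico (i + 1) j, ‖u (k + 1) - u k‖) + ‖b - u j‖

/-- The point set of the subpath of the path `u 0, …, u n` from a point `a` on the `i`-th
edge to a point `b` on the `j`-th edge (for `i ≤ j`). -/
def subSet (u : ℕ → Plane) (i j : ℕ) (a b : Plane) : Set Plane :=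
  if i = j then segment ℝ a b
  else segment ℝ a (u (i + 1)) ∪
    (⋃ k ∈ Finset.Ico (i + 1) j, segment ℝ (u k) (u (k + 1))) ∪ segment ℝ (u j) b

/-- A tame path: an `x`-monotone (nondecreasing) rectilinear path such that for every
horizontal chord `ab` (with `a`, `b` on the path and the segment `ab` contained in the
region below the path), the subpath between `a` and `b` has length at most `2·‖a − b‖`. -/
def IsTamePath (n : ℕ) (u : ℕ → Plane) : Prop :=
  IsRectilinear n u ∧ (∀ i < n, u i 0 ≤ u (i + 1) 0) ∧
  ∀ (i j : ℕ) (a b : Plane), i ≤ j → j < n →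
    a ∈ segment ℝ (u i) (u (i + 1)) → b ∈ segment ℝ (u j) (u (j + 1)) →
    a 1 = b 1 → segment ℝ a b ⊆ belowRegion (pathSet n u) →
    subLen u i j a b ≤ 2 * ‖a - b‖

/-- The total length of the horizontal edges of a rectilinear path. -/
def hper (n : ℕ) (u : ℕ → Plane) : ℝ :=
  ∑ i ∈ Finset.range n, |u (i + 1) 0 - u i 0|

/-- The tame histogram bounded below by the horizontal segment from `u 0` to `u n` and
above by the tame path `u 0, …, u n` :
`{(x,y) : x(p) ≤ x ≤ x(q), y(p) ≤ y ≤ max{y' : (x,y') ∈ L}}`. -/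
def histRegion (n : ℕ) (u : ℕ → Plane) : Set Plane :=
  {z | u 0 0 ≤ z 0 ∧ z 0 ≤ u n 0 ∧ u 0 1 ≤ z 1 ∧
    ∃ q ∈ pathSet n u, q 0 = z 0 ∧ z 1 ≤ q 1}

@[simp] lemma pt_zero (x y : ℝ) : pt x y 0 = x := by simp [pt]

@[simp] lemma pt_one (x y : ℝ) : pt x y 1 = y := by simp [pt]

lemma plane_ext {p q : Plane} (h0 : p 0 = q 0) (h1 : p 1 = q 1) : p = q := by
  ext i
  fin_cases i
  · exact h0
  · exact h1

lemma pt_eta (p : Plane) : pt (p 0) (p 1) = p := plane_ext (by simp) (by simp)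

lemma norm_sub_eq_sqrt (p q : Plane) :
    ‖p - q‖ = Real.sqrt ((p 0 - q 0) ^ 2 + (p 1 - q 1) ^ 2) := by
  rw [EuclideanSpace.norm_eq]
  simp [Fin.sum_univ_two]

lemma norm_sub_le_of_sq_le {p q : Plane} {w : ℝ} (hw : 0 ≤ w)
    (h : (p 0 - q 0) ^ 2 + (p 1 - q 1) ^ 2 ≤ w ^ 2) : ‖p - q‖ ≤ w := by
  rw [norm_sub_eq_sqrt]
  exact Real.sqrt_le_iff.2 ⟨hw, h⟩

lemma norm_sub_le_abs_add_abs (p q : Plane) : ‖p - q‖ ≤ |p 0 - q 0| + |p 1 - q 1| := by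
  apply norm_sub_le_of_sq_le (by positivity)
  have h0 := sq_abs (p 0 - q 0)
  have h1 := sq_abs (p 1 - q 1)
  nlinarith [mul_nonneg (abs_nonneg (p 0 - q 0)) (abs_nonneg (p 1 - q 1))]

lemma abs_snd_sub_le_norm (p q : Plane) : |p 1 - q 1| ≤ ‖p - q‖ := by
  rw [norm_sub_eq_sqrt]
  apply Real.abs_le_sqrt
  nlinarith [sq_nonneg (p 0 - q 0)]

/-- The length of a steep segment exceeds its height by at most `d² / (2h)`. -/
lemma norm_sub_le_height_add {p q : Plane} {d h w : ℝ} (hh : 0 < h) (h1 : |p 1 - q 1| = h)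
    (h0 : |p 0 - q 0| ≤ d) (hw : d ^ 2 ≤ 2 * h * w) : ‖p - q‖ ≤ h + w := by
  have hd : 0 ≤ d := (abs_nonneg _).trans h0
  have hw0 : 0 ≤ w := by
    by_contra hneg
    push Not at hneg
    nlinarith [mul_pos hh (neg_pos.2 hneg), sq_nonneg d]
  apply norm_sub_le_of_sq_le (by positivity)
  have e1 : (p 1 - q 1) ^ 2 = h ^ 2 := by rw [← sq_abs, h1]
  have e0 : (p 0 - q 0) ^ 2 ≤ d ^ 2 := by
    rw [← sq_abs]
    exact pow_le_pow_left₀ (abs_nonneg _) h0 2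
  nlinarith [sq_nonneg w]

lemma norm_sub_of_snd_eq {p q : Plane} (h : p 1 = q 1) : ‖p - q‖ = |p 0 - q 0| := by
  rw [norm_sub_eq_sqrt, h]
  simp [Real.sqrt_sq_eq_abs]

lemma norm_sub_of_fst_eq {p q : Plane} (h : p 0 = q 0) : ‖p - q‖ = |p 1 - q 1| := by
  rw [norm_sub_eq_sqrt, h]
  simp [Real.sqrt_sq_eq_abs]

lemma pt_mem_segment {x₁ y₁ x₂ y₂ τ x y : ℝ} (h0 : 0 ≤ τ) (h1 : τ ≤ 1)
    (hx : x = x₁ + τ * (x₂ - x₁)) (hy : y = y₁ + τ * (y₂ - y₁)) :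
    pt x y ∈ segment ℝ (pt x₁ y₁) (pt x₂ y₂) := by
  refine ⟨1 - τ, τ, by linarith, h0, by ring, plane_ext ?_ ?_⟩
  · simp [hx]; ring
  · simp [hy]; ring

lemma pt_mem_segment_horizontal {x₁ x₂ x : ℝ} (y : ℝ) (h1 : x₁ ≤ x) (h2 : x ≤ x₂) :
    pt x y ∈ segment ℝ (pt x₁ y) (pt x₂ y) := by
  rcases eq_or_lt_of_le (h1.trans h2) with h | h
  · have hx : x = x₁ := by linarith
    rw [hx]
    exact left_mem_segment ℝ _ _
  · refine pt_mem_segment (τ := (x - x₁) / (x₂ - x₁)) ?_ ?_ ?_ ?_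
    · exact div_nonneg (by linarith) (by linarith)
    · rw [div_le_one (by linarith)]; linarith
    · have : x₂ - x₁ ≠ 0 := by linarith
      field_simp
      ring
    · ring

lemma pt_mem_segment_vertical (x : ℝ) {y₁ y₂ y : ℝ} (h1 : y₁ ≤ y) (h2 : y ≤ y₂) :
    pt x y ∈ segment ℝ (pt x y₁) (pt x y₂) := by
  rcases eq_or_lt_of_le (h1.trans h2) with h | h
  · have hy : y = y₁ := by linarith
    rw [hy]
    exact left_mem_segment ℝ _ _
  · refine pt_mem_segment (τ := (y - y₁) / (y₂ - y₁)) ?_ ?_ ?_ ?_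
    · exact div_nonneg (by linarith) (by linarith)
    · rw [div_le_one (by linarith)]; linarith
    · ring
    · have : y₂ - y₁ ≠ 0 := by linarith
      field_simp
      ring

/-! ### Weights of geometric graphs -/

lemma gweight_union_le (E F : Finset (Plane × Plane)) :
    gweight (E ∪ F) ≤ gweight E + gweight F := by
  unfold gweight
  rw [← Finset.sum_union_inter]
  exact le_add_of_nonneg_right (Finset.sum_nonneg fun _ _ => norm_nonneg _)

lemma gweight_empty : gweight ∅ = 0 := by simp [gweight]

lemma gweight_singleton (e : Plane × Plane) : gweight {e} = ‖e.1 - e.2‖ := by simp [gweight]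

lemma gweight_biUnion_le {ι : Type*} (s : Finset ι) (f : ι → Finset (Plane × Plane)) :
    gweight (s.biUnion f) ≤ ∑ i ∈ s, gweight (f i) := by
  induction s using Finset.induction_on with
  | empty => simp [gweight]
  | insert a s ha ih =>
    rw [Finset.biUnion_insert, Finset.sum_insert ha]
    exact (gweight_union_le _ _).trans (by linarith)

lemma gweight_image_le {ι : Type*} (s : Finset ι) (f : ι → Plane × Plane) :
    gweight (s.image f) ≤ ∑ i ∈ s, ‖(f i).1 - (f i).2‖ := by
  rw [← Finset.biUnion_singleton]
  exact (gweight_biUnion_le s _).trans (le_of_eq (by simp [gweight]))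

lemma gweight_image_le_card_mul {ι : Type*} (s : Finset ι) (f : ι → Plane × Plane) {ℓ : ℝ}
    (h : ∀ i ∈ s, ‖(f i).1 - (f i).2‖ ≤ ℓ) : gweight (s.image f) ≤ s.card * ℓ := by
  refine (gweight_image_le s f).trans ?_
  have := Finset.sum_le_card_nsmul s _ ℓ h
  simpa using this

/-! ### Paths in geometric graphs -/

lemma segUnion_mono {E F : Finset (Plane × Plane)} (h : E ⊆ F) : segUnion E ⊆ segUnion F :=
  Set.biUnion_subset_biUnion_left h

namespace HasPath

variable {E F : Finset (Plane × Plane)} {a b c : Plane} {w w' : ℝ}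

lemma refl (E : Finset (Plane × Plane)) (a : Plane) : HasPath E a a 0 :=
  ⟨0, fun _ => a, rfl, rfl, by simp, by simp⟩

lemma mono_weight (h : HasPath E a b w) (hw : w ≤ w') : HasPath E a b w' := by
  obtain ⟨m, v, h0, h1, h2, h3⟩ := h
  exact ⟨m, v, h0, h1, h2, h3.trans hw⟩

lemma mono (h : HasPath E a b w) (hE : E ⊆ F) : HasPath F a b w := by
  obtain ⟨m, v, h0, h1, h2, h3⟩ := h
  exact ⟨m, v, h0, h1, fun i hi => (h2 i hi).trans (segUnion_mono hE), h3⟩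

lemma of_segment_subset (h : segment ℝ a b ⊆ segUnion E) : HasPath E a b ‖a - b‖ := by
  refine ⟨1, fun i => if i = 0 then a else b, by simp, by simp, ?_, ?_⟩
  · intro i hi
    have : i = 0 := by omega
    subst this
    simpa using h
  · simp [norm_sub_rev]

lemma of_mem {e : Plane × Plane} (he : e ∈ E) (ha : a ∈ segment ℝ e.1 e.2)
    (hb : b ∈ segment ℝ e.1 e.2) : HasPath E a b ‖a - b‖ := by
  apply of_segment_subset
  intro z hz
  simp only [segUnion, Set.mem_iUnion]
  exact ⟨e, he, (convex_segment e.1 e.2).segment_subset ha hb hz⟩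

lemma of_edge (he : (a, b) ∈ E) : HasPath E a b ‖a - b‖ :=
  of_mem he (left_mem_segment ℝ _ _) (right_mem_segment ℝ _ _)

lemma symm (h : HasPath E a b w) : HasPath E b a w := by
  obtain ⟨m, v, h0, h1, h2, h3⟩ := h
  refine ⟨m, fun i => v (m - i), by simpa using h1, by simpa using h0, ?_, ?_⟩
  · intro i hi
    have := h2 (m - (i + 1)) (by omega)
    rw [show m - (i + 1) + 1 = m - i by omega, segment_symm] at this
    exact this
  · refine le_trans (le_of_eq ?_) h3
    rw [← Finset.sum_range_reflect (fun i => ‖v (i + 1) - v i‖) m]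
    refine Finset.sum_congr rfl fun i hi => ?_
    rw [Finset.mem_range] at hi
    rw [norm_sub_rev, show m - 1 - i + 1 = m - i by omega, show m - 1 - i = m - (i + 1) by omega]

lemma trans (h : HasPath E a b w) (h' : HasPath E b c w') : HasPath E a c (w + w') := by
  obtain ⟨m, v, h0, h1, h2, h3⟩ := h
  obtain ⟨m', v', h0', h1', h2', h3'⟩ := h'
  have key : ∀ i, (if m + i ≤ m then v (m + i) else v' (m + i - m)) = v' i := by
    intro i
    rcases Nat.eq_zero_or_pos i with rfl | hi
    · simp [h1, h0']
    · rw [if_neg (by omega)]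
      congr 1
      omega
  refine ⟨m + m', fun i => if i ≤ m then v i else v' (i - m), by simpa using h0, ?_, ?_, ?_⟩
  · simpa [h1'] using key m'
  · intro i hi
    by_cases him : i < m
    · simpa [him.le, Nat.succ_le_of_lt him] using h2 i him
    · obtain ⟨j, rfl⟩ := Nat.exists_eq_add_of_le (not_lt.1 him)
      have e1 := key j
      have e2 := key (j + 1)
      rw [← add_assoc] at e2
      simp only [e1, e2]
      exact h2' j (by omega)
  · rw [Finset.sum_range_add]
    refine add_le_add (le_trans (le_of_eq ?_) h3) (le_trans (le_of_eq ?_) h3')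
    · refine Finset.sum_congr rfl fun i hi => ?_
      rw [Finset.mem_range] at hi
      simp [hi.le, Nat.succ_le_of_lt hi]
    · refine Finset.sum_congr rfl fun j _ => ?_
      have e1 := key j
      have e2 := key (j + 1)
      rw [← add_assoc] at e2
      simp only [e1, e2]

lemma map (h : HasPath E a b w) (ρ : Plane →ₗ[ℝ] Plane) (hρ : ∀ p, ‖ρ p‖ = ‖p‖) :
    HasPath (E.image (Prod.map ρ ρ)) (ρ a) (ρ b) w := by
  obtain ⟨m, v, h0, h1, h2, h3⟩ := h
  refine ⟨m, fun i => ρ (v i), by simp [h0], by simp [h1], ?_, ?_⟩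
  · intro i hi
    have himg := image_segment ℝ ρ.toAffineMap (v i) (v (i + 1))
    simp only [LinearMap.coe_toAffineMap] at himg
    rw [← himg]
    rintro _ ⟨z, hz, rfl⟩
    have hz' := h2 i hi hz
    simp only [segUnion, Set.mem_iUnion] at hz' ⊢
    obtain ⟨e, he, hze⟩ := hz'
    refine ⟨Prod.map ρ ρ e, Finset.mem_image_of_mem _ he, ?_⟩
    have himg' := image_segment ℝ ρ.toAffineMap e.1 e.2
    simp only [LinearMap.coe_toAffineMap] at himg'
    simp only [Prod.map_fst, Prod.map_snd]
    rw [← himg']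
    exact ⟨z, hze, rfl⟩
  · simpa [← map_sub, hρ] using h3

lemma horizontal {x₁ x₂ x x' y : ℝ} (he : (pt x₁ y, pt x₂ y) ∈ E) (h1 : x₁ ≤ x) (h2 : x ≤ x₂)
    (h1' : x₁ ≤ x') (h2' : x' ≤ x₂) : HasPath E (pt x y) (pt x' y) |x - x'| := by
  refine (of_mem he (pt_mem_segment_horizontal y h1 h2)
    (pt_mem_segment_horizontal y h1' h2')).mono_weight (le_of_eq ?_)
  rw [norm_sub_of_snd_eq (by simp)]
  simp

lemma vertical {x y₁ y₂ y y' : ℝ} (he : (pt x y₁, pt x y₂) ∈ E) (h1 : y₁ ≤ y) (h2 : y ≤ y₂)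
    (h1' : y₁ ≤ y') (h2' : y' ≤ y₂) : HasPath E (pt x y) (pt x y') |y - y'| := by
  refine (of_mem he (pt_mem_segment_vertical x h1 h2)
    (pt_mem_segment_vertical x h1' h2')).mono_weight (le_of_eq ?_)
  rw [norm_sub_of_fst_eq (by simp)]
  simp

end HasPath

/-! ### Rectilinear curves parametrized by arc length -/

/-- An injective rectilinear curve `t ↦ (x t, y t)`, parametrized by arc length, with nodes at the
parameters `σ 0 ≤ ⋯ ≤ σ N`, moving right, up or down between consecutive nodes, and satisfying the
tameness condition for horizontal chords below the curve. -/
structure IsTameCurve (N : ℕ) (σ : ℕ → ℝ) (x y : ℝ → ℝ) : Prop where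
  mono : Monotone σ
  cont_x : Continuous x
  cont_y : Continuous y
  edge : ∀ i < N,
    (∀ t ∈ Set.Icc (σ i) (σ (i + 1)), x t = x (σ i) + (t - σ i) ∧ y t = y (σ i)) ∨
    (∀ t ∈ Set.Icc (σ i) (σ (i + 1)), x t = x (σ i) ∧ y t = y (σ i) + (t - σ i)) ∨
    (∀ t ∈ Set.Icc (σ i) (σ (i + 1)), x t = x (σ i) ∧ y t = y (σ i) - (t - σ i))
  tame : ∀ s t, σ 0 ≤ s → s ≤ t → t ≤ σ N → y s = y t → (∀ r ∈ Set.Icc s t, y s ≤ y r) →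
    t - s ≤ 2 * (x t - x s)
  inj : ∀ s t, σ 0 ≤ s → s ≤ t → t ≤ σ N → x s = x t → y s = y t → s = t

/-- A continuous function crossing the level `c` upwards has a last crossing. -/
lemma exists_last_crossing_lt {f : ℝ → ℝ} (hf : Continuous f) {s t c : ℝ} (hst : s ≤ t)
    (hs : f s ≤ c) (ht : c ≤ f t) :
    ∃ r ∈ Set.Icc s t, f r = c ∧ ∀ q ∈ Set.Ioc r t, c < f q := by
  have hne : (Set.Icc s t ∩ f ⁻¹' {c}).Nonempty := by
    obtain ⟨r, hr, hrc⟩ := intermediate_value_Icc hst hf.continuousOn ⟨hs, ht⟩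
    exact ⟨r, hr, hrc⟩
  have hcomp : IsCompact (Set.Icc s t ∩ f ⁻¹' {c}) :=
    isCompact_Icc.inter_right (isClosed_singleton.preimage hf)
  obtain ⟨r, ⟨hr, hrc⟩, hmax⟩ := hcomp.exists_isGreatest hne
  refine ⟨r, hr, hrc, fun q hq => ?_⟩
  by_contra hlt
  push Not at hlt
  obtain ⟨r', hr', hrc'⟩ := intermediate_value_Icc hq.2 hf.continuousOn ⟨hlt, ht⟩
  have h1 : r' ≤ r := hmax ⟨⟨hr.1.trans (hq.1.le.trans hr'.1), hr'.2⟩, hrc'⟩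
  linarith [hq.1, hr'.1]

lemma exists_last_crossing {f : ℝ → ℝ} (hf : Continuous f) {s t c : ℝ} (hst : s ≤ t)
    (hs : f s ≤ c) (ht : c ≤ f t) :
    ∃ r ∈ Set.Icc s t, f r = c ∧ ∀ q ∈ Set.Icc r t, c ≤ f q := by
  obtain ⟨r, hr, hrc, h⟩ := exists_last_crossing_lt hf hst hs ht
  refine ⟨r, hr, hrc, fun q hq => ?_⟩
  rcases hq.1.eq_or_lt with rfl | hlt
  · exact hrc.ge
  · exact (h q ⟨hlt, hq.2⟩).le

/-- A continuous function crossing the level `c` downwards has a first crossing. -/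
lemma exists_first_crossing_lt {f : ℝ → ℝ} (hf : Continuous f) {s t c : ℝ} (hst : s ≤ t)
    (hs : c ≤ f s) (ht : f t ≤ c) :
    ∃ r ∈ Set.Icc s t, f r = c ∧ ∀ q ∈ Set.Ico s r, c < f q := by
  obtain ⟨r, hr, hrc, h⟩ := exists_last_crossing_lt (f := fun r => f (-r))
    (hf.comp continuous_neg) (s := -t) (t := -s) (c := c) (by linarith) (by simpa using ht)
    (by simpa using hs)
  refine ⟨-r, ⟨by linarith [hr.2], by linarith [hr.1]⟩, hrc, fun q hq => ?_⟩
  simpa using h (-q) ⟨by linarith [hq.2], by linarith [hq.1]⟩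

lemma monotoneOn_of_monotoneOn_edges {f : ℝ → ℝ} {σ : ℕ → ℝ} (hσ : Monotone σ) :
    ∀ N : ℕ, (∀ i < N, MonotoneOn f (Set.Icc (σ i) (σ (i + 1)))) →
      MonotoneOn f (Set.Icc (σ 0) (σ N)) := by
  intro N
  induction N with
  | zero =>
    intro _ a ha b hb _
    have h1 : a = σ 0 := le_antisymm ha.2 ha.1
    have h2 : b = σ 0 := le_antisymm hb.2 hb.1
    rw [h1, h2]
  | succ N ih =>
    intro h
    have h1 := ih fun i hi => h i (by omega)
    have h2 := h N (by omega)
    have := h1.union_right h2 (c := σ N) (isGreatest_Icc (hσ (Nat.zero_le N)))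
      (isLeast_Icc (hσ (Nat.le_succ N)))
    rwa [Set.Icc_union_Icc_eq_Icc (hσ (Nat.zero_le N)) (hσ (Nat.le_succ N))] at this

/-- Every parameter lies on some edge. -/
lemma exists_edge_of_mem_Icc {σ : ℕ → ℝ} {M : ℕ} : ∀ {N : ℕ} {t : ℝ}, M < N →
    σ M ≤ t → t ≤ σ N → ∃ i, M ≤ i ∧ i < N ∧ t ∈ Set.Icc (σ i) (σ (i + 1)) := by
  intro N
  induction N with
  | zero => intro t h; omega
  | succ N ih =>
    intro t hMN h0 h1
    by_cases h : σ N ≤ t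
    · exact ⟨N, by omega, by omega, h, h1⟩
    · push Not at h
      have hMN' : M < N := by
        rcases Nat.lt_succ_iff_lt_or_eq.1 hMN with h' | h'
        · exact h'
        · subst h'; linarith
      obtain ⟨i, hi1, hi2, hi⟩ := ih hMN' h0 h.le
      exact ⟨i, hi1, by omega, hi⟩

namespace IsTameCurve

variable {N : ℕ} {σ : ℕ → ℝ} {x y : ℝ → ℝ}

lemma node_mem (h : IsTameCurve N σ x y) {i : ℕ} (hi : i ≤ N) : σ i ∈ Set.Icc (σ 0) (σ N) :=
  ⟨h.mono (Nat.zero_le i), h.mono hi⟩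

lemma x_monotoneOn (h : IsTameCurve N σ x y) : MonotoneOn x (Set.Icc (σ 0) (σ N)) := by
  refine monotoneOn_of_monotoneOn_edges h.mono N fun i hi a ha b hb hab => ?_
  rcases h.edge i hi with e | e | e <;> linarith [(e a ha).1, (e b hb).1]

lemma x_le (h : IsTameCurve N σ x y) {s t : ℝ} (hs : σ 0 ≤ s) (hst : s ≤ t) (ht : t ≤ σ N) :
    x s ≤ x t :=
  h.x_monotoneOn ⟨hs, hst.trans ht⟩ ⟨hs.trans hst, ht⟩ hst

/-- The arc length bounds the `ℓ¹` distance. -/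
lemma sub_add_abs_sub_le (h : IsTameCurve N σ x y) {s t : ℝ} (hs : σ 0 ≤ s) (hst : s ≤ t)
    (ht : t ≤ σ N) : x t - x s + |y t - y s| ≤ t - s := by
  have h1 : MonotoneOn (fun r => r - x r - y r) (Set.Icc (σ 0) (σ N)) := by
    refine monotoneOn_of_monotoneOn_edges h.mono N fun i hi a ha b hb hab => ?_
    rcases h.edge i hi with e | e | e <;>
      linarith [(e a ha).1, (e b hb).1, (e a ha).2, (e b hb).2]
  have h2 : MonotoneOn (fun r => r - x r + y r) (Set.Icc (σ 0) (σ N)) := by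
    refine monotoneOn_of_monotoneOn_edges h.mono N fun i hi a ha b hb hab => ?_
    rcases h.edge i hi with e | e | e <;>
      linarith [(e a ha).1, (e b hb).1, (e a ha).2, (e b hb).2]
  have e1 := h1 ⟨hs, hst.trans ht⟩ ⟨hs.trans hst, ht⟩ hst
  have e2 := h2 ⟨hs, hst.trans ht⟩ ⟨hs.trans hst, ht⟩ hst
  simp only at e1 e2
  rcases abs_cases (y t - y s) with ⟨e, _⟩ | ⟨e, _⟩ <;> linarith

/-- A linear function of the coordinates is monotone or antitone along each edge. -/
lemma linear_le_max (h : IsTameCurve N σ x y) (α β : ℝ) {i : ℕ} (hi : i < N) {t : ℝ}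
    (ht : t ∈ Set.Icc (σ i) (σ (i + 1))) :
    α * y t + β * x t ≤ max (α * y (σ i) + β * x (σ i))
      (α * y (σ (i + 1)) + β * x (σ (i + 1))) := by
  have key : ∀ c d : ℝ, c * (t - σ i) + d ≤ max d (c * (σ (i + 1) - σ i) + d) := by
    intro c d
    have h1 := ht.1
    have h2 := ht.2
    rcases le_total 0 c with hc | hc
    · exact le_max_of_le_right (by nlinarith)
    · exact le_max_of_le_left (by nlinarith)
  have h' : σ (i + 1) ∈ Set.Icc (σ i) (σ (i + 1)) := ⟨h.mono (Nat.le_succ i), le_rfl⟩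
  obtain ⟨c, hc⟩ : ∃ c : ℝ, ∀ r ∈ Set.Icc (σ i) (σ (i + 1)),
      α * y r + β * x r = c * (r - σ i) + (α * y (σ i) + β * x (σ i)) := by
    rcases h.edge i hi with e | e | e
    · exact ⟨β, fun r hr => by rw [(e r hr).1, (e r hr).2]; ring⟩
    · exact ⟨α, fun r hr => by rw [(e r hr).1, (e r hr).2]; ring⟩
    · exact ⟨-α, fun r hr => by rw [(e r hr).1, (e r hr).2]; ring⟩
  rw [hc t ht, hc _ h']
  exact key _ _

/-- A bound on a linear function at the nodes holds along the curve. -/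
lemma linear_le_of_nodes (h : IsTameCurve N σ x y) (α β B : ℝ) {i j : ℕ} (hij : i ≤ j)
    (hj : j ≤ N) (hB : ∀ k, i ≤ k → k ≤ j → α * y (σ k) + β * x (σ k) ≤ B) {t : ℝ}
    (h1 : σ i ≤ t) (h2 : t ≤ σ j) : α * y t + β * x t ≤ B := by
  rcases hij.eq_or_lt with rfl | hlt
  · rw [le_antisymm h2 h1]
    exact hB i le_rfl le_rfl
  · obtain ⟨k, hk1, hk2, hk⟩ := exists_edge_of_mem_Icc hlt h1 h2
    refine (h.linear_le_max α β (by omega) hk).trans (max_le ?_ ?_)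
    · exact hB k hk1 hk2.le
    · exact hB (k + 1) (by omega) hk2

/-- The length of an arc staying above its starting level. -/
lemma length_le_of_forall_le (h : IsTameCurve N σ x y) {s t : ℝ} (hs : σ 0 ≤ s) (hst : s ≤ t)
    (ht : t ≤ σ N) (hy : ∀ r ∈ Set.Icc s t, y s ≤ y r) :
    t - s ≤ 2 * (x t - x s) + (y t - y s) := by
  suffices H : ∀ k ≤ N, ∀ t, s ≤ t → t ≤ σ k → (∀ r ∈ Set.Icc s t, y s ≤ y r) →
      t - s ≤ 2 * (x t - x s) + (y t - y s) from H N le_rfl t hst ht hy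
  intro k
  induction k with
  | zero =>
    intro _ t hst ht _
    have : t = s := by linarith
    simp [this]
  | succ k ih =>
    intro hk t hst ht hy
    by_cases htk : t ≤ σ k
    · exact ih (by omega) t hst htk hy
    · push Not at htk
      have hkm : σ k ≤ σ (k + 1) := h.mono (Nat.le_succ k)
      have hkN : σ (k + 1) ≤ σ N := h.mono hk
      have htE : t ∈ Set.Icc (σ k) (σ (k + 1)) := ⟨htk.le, ht⟩
      by_cases hsk : σ k ≤ s
      · have hsE : s ∈ Set.Icc (σ k) (σ (k + 1)) := ⟨hsk, hst.trans ht⟩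
        have := hy t ⟨hst, le_rfl⟩
        rcases h.edge k (by omega) with e | e | e <;>
          linarith [(e t htE).1, (e t htE).2, (e s hsE).1, (e s hsE).2]
      · push Not at hsk
        have hI := ih (by omega) (σ k) hsk.le le_rfl fun r hr => hy r ⟨hr.1, hr.2.trans htk.le⟩
        rcases h.edge k (by omega) with e | e | e
        · linarith [(e t htE).1, (e t htE).2]
        · linarith [(e t htE).1, (e t htE).2]
        · obtain ⟨r, hr, hrt, hr'⟩ := exists_last_crossing h.cont_y hsk.le
            (hy t ⟨hst, le_rfl⟩) (c := y t) (by linarith [(e t htE).2])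
          have h1 := ih (by omega) r hr.1 hr.2 fun q hq => hy q ⟨hq.1, by linarith [hq.2, hr.2]⟩
          have h2 := h.tame r t (by linarith [hr.1]) (by linarith [hr.2]) (by linarith) hrt
            (fun q hq => by
              rw [hrt]
              by_cases hqk : q ≤ σ k
              · exact hr' q ⟨hq.1, hqk⟩
              · push Not at hqk
                linarith [(e t htE).2, (e q ⟨hqk.le, hq.2.trans ht⟩).2, hq.2])
          linarith

/-- A descent from a peak `P` of `3θy - 2x` is short compared to its width. -/
lemma peak_bounds (h : IsTameCurve N σ x y) {θ b P p : ℝ} (hθ : θ ≤ 1)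
    (hb : σ 0 ≤ b) (hbP : b ≤ P) (hPp : P ≤ p) (hp : p ≤ σ N)
    (hF : ∀ r ∈ Set.Icc b P, 3 * θ * y r - 2 * x r ≤ 3 * θ * y P - 2 * x P)
    (hyb : y b ≤ y p) (hyP : y p ≤ y P) (hmin : ∀ r ∈ Set.Icc P p, y p ≤ y r) :
    y P - y p ≤ 2 * (x p - x P) ∧ p - P ≤ 8 * (x p - x P) := by
  obtain ⟨l, hl, hlp, hl'⟩ := exists_last_crossing h.cont_y hbP hyb hyP
  have h1 := h.tame l p (by linarith [hl.1]) (by linarith [hl.2]) hp hlp fun r hr => by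
    rw [hlp]
    rcases le_total r P with hrP | hrP
    · exact hl' r ⟨hr.1, hrP⟩
    · exact hmin r ⟨hrP, hr.2⟩
  have h2 := h.sub_add_abs_sub_le (by linarith [hl.1] : σ 0 ≤ l) hl.2 (by linarith)
  have h3 := h.sub_add_abs_sub_le (by linarith) hPp hp
  have h4 := le_abs_self (y P - y l)
  have h5 := neg_abs_le (y p - y P)
  have h6 := hF l hl
  have h7 : θ * (y P - y p) ≤ 1 * (y P - y p) := mul_le_mul_of_nonneg_right hθ (by linarith)
  rw [hlp] at h4 h6 h2
  constructor <;> nlinarith [hl.2]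

/-- The arc from a peak `P` of `3θy - 2x` to a point of its pool. -/
lemma pool_bounds (h : IsTameCurve N σ x y) {θ b P a : ℝ} (hθ : θ ≤ 1)
    (hb : σ 0 ≤ b) (hbP : b ≤ P) (hPa : P ≤ a) (ha : a ≤ σ N)
    (hF : ∀ r ∈ Set.Icc b a, 3 * θ * y r - 2 * x r ≤ 3 * θ * y P - 2 * x P)
    (hyb : ∀ r ∈ Set.Icc b a, y b ≤ y r) :
    y P - y a ≤ 2 * (x a - x P) ∧ a - P ≤ 12 * (x a - x P) + (y a - y P) := by
  obtain ⟨p, hp, hpmin⟩ := isCompact_Icc.exists_isMinOn (Set.nonempty_Icc.2 hPa)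
    h.cont_y.continuousOn
  rw [isMinOn_iff] at hpmin
  have h1 := h.peak_bounds hθ hb hbP hp.1 (hp.2.trans ha)
    (fun r hr => hF r ⟨hr.1, hr.2.trans hPa⟩) (hyb p ⟨hbP.trans hp.1, hp.2⟩)
    (hpmin P ⟨le_rfl, hPa⟩) fun r hr => hpmin r ⟨hr.1, hr.2.trans hp.2⟩
  have h2 := h.length_le_of_forall_le (by linarith [hp.1]) hp.2 ha
    fun r hr => hpmin r ⟨hp.1.trans hr.1, hr.2⟩
  have h3 := hpmin a ⟨hPa, le_rfl⟩
  have h4 := h.x_le (by linarith) hp.1 (hp.2.trans ha)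
  have h5 := h.x_le (by linarith [hp.1]) hp.2 ha
  constructor <;> linarith [h1.1, h1.2]

end IsTameCurve

/-- The edges of a rectilinear curve between consecutive nodes, as a geometric graph. -/
def curveEdges (N : ℕ) (σ : ℕ → ℝ) (x y : ℝ → ℝ) : Finset (Plane × Plane) :=
  (Finset.range N).image fun i =>
    (pt (x (σ i)) (y (σ i)), pt (x (σ (i + 1))) (y (σ (i + 1))))

/-- A comb: vertical columns at spacing `μ` to the right of the parameter `s`, and horizontal spurs
joining points at spacing `μ` along the curve to the next column on the left. -/
def comb (x y : ℝ → ℝ) (s sN μ : ℝ) (K J : ℕ) (Ylo Yhi : ℝ) : Finset (Plane × Plane) :=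
  ((Finset.range (K + 1)).image fun k : ℕ => (pt (x s + k * μ) Ylo, pt (x s + k * μ) Yhi)) ∪
  ((Finset.range (J + 1)).filter fun j : ℕ => s + j * μ ≤ sN).image fun j : ℕ =>
    (pt (x s + ⌊(x (s + j * μ) - x s) / μ⌋₊ * μ) (y (s + j * μ)),
      pt (x (s + j * μ)) (y (s + j * μ)))

lemma floor_mul_le_and_sub_le {μ d : ℝ} (hμ : 0 < μ) (hd : 0 ≤ d) :
    (⌊d / μ⌋₊ : ℝ) * μ ≤ d ∧ d - ⌊d / μ⌋₊ * μ ≤ μ := by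
  have h1 := Nat.floor_le (div_nonneg hd hμ.le)
  have h2 := Nat.lt_floor_add_one (d / μ)
  rw [le_div_iff₀ hμ] at h1
  rw [div_lt_iff₀ hμ] at h2
  exact ⟨h1, by linarith⟩

namespace IsTameCurve

variable {N : ℕ} {σ : ℕ → ℝ} {x y : ℝ → ℝ}

lemma gweight_curveEdges_le (h : IsTameCurve N σ x y) :
    gweight (curveEdges N σ x y) ≤ σ N - σ 0 := by
  rw [← Finset.sum_range_sub σ N]
  refine (gweight_image_le _ _).trans (Finset.sum_le_sum fun i hi => ?_)
  rw [Finset.mem_range] at hi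
  have hm := h.mono (Nat.le_succ i)
  have h1 := h.sub_add_abs_sub_le (h.node_mem hi.le).1 hm (h.mono hi)
  have h2 := h.x_le (h.node_mem hi.le).1 hm (h.mono hi)
  rw [norm_sub_rev]
  refine (norm_sub_le_abs_add_abs _ _).trans ?_
  simp only [pt_zero, pt_one]
  rwa [abs_of_nonneg (sub_nonneg.2 h2)]

/-- The curve edges contain the arcs of the curve. -/
lemma hasPath_arc (h : IsTameCurve N σ x y) {s t : ℝ} (hs : σ 0 ≤ s) (hst : s ≤ t)
    (ht : t ≤ σ N) :
    HasPath (curveEdges N σ x y) (pt (x s) (y s)) (pt (x t) (y t)) (t - s) := by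
  have hedge : ∀ i < N, ∀ a ∈ Set.Icc (σ i) (σ (i + 1)), ∀ b ∈ Set.Icc (σ i) (σ (i + 1)), a ≤ b →
      HasPath (curveEdges N σ x y) (pt (x a) (y a)) (pt (x b) (y b)) (b - a) := by
    intro i hi a ha b hb hab
    have hm : σ i ≤ σ (i + 1) := h.mono (Nat.le_succ i)
    have hmem : ∀ c ∈ Set.Icc (σ i) (σ (i + 1)), pt (x c) (y c) ∈
        segment ℝ (pt (x (σ i)) (y (σ i))) (pt (x (σ (i + 1))) (y (σ (i + 1)))) := by
      intro c hc
      have h' : σ (i + 1) ∈ Set.Icc (σ i) (σ (i + 1)) := ⟨hm, le_rfl⟩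
      rcases hm.eq_or_lt with heq | hlt
      · have : c = σ i := le_antisymm (by rw [heq]; exact hc.2) hc.1
        rw [this]
        exact left_mem_segment ℝ _ _
      · have hpos : 0 < σ (i + 1) - σ i := by linarith
        refine pt_mem_segment (τ := (c - σ i) / (σ (i + 1) - σ i))
          (div_nonneg (by linarith [hc.1]) hpos.le)
          ((div_le_one hpos).2 (by linarith [hc.2])) ?_ ?_ <;>
        · rcases h.edge i hi with e | e | e <;>
          · first
            | rw [(e c hc).1, (e _ h').1]
            | rw [(e c hc).2, (e _ h').2]
            field_simp
            ring
    have he : (pt (x (σ i)) (y (σ i)), pt (x (σ (i + 1))) (y (σ (i + 1)))) ∈ curveEdges N σ x y :=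
      Finset.mem_image.2 ⟨i, Finset.mem_range.2 hi, rfl⟩
    refine (HasPath.of_mem he (hmem a ha) (hmem b hb)).mono_weight ?_
    have ha0 : σ 0 ≤ a := (h.node_mem hi.le).1.trans ha.1
    have hbN : b ≤ σ N := hb.2.trans (h.mono hi)
    have h1 := h.sub_add_abs_sub_le ha0 hab hbN
    have h2 := h.x_le ha0 hab hbN
    rw [norm_sub_rev]
    refine (norm_sub_le_abs_add_abs _ _).trans ?_
    simp only [pt_zero, pt_one]
    rwa [abs_of_nonneg (sub_nonneg.2 h2)]
  suffices H : ∀ k ≤ N, ∀ t, s ≤ t → t ≤ σ k →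
      HasPath (curveEdges N σ x y) (pt (x s) (y s)) (pt (x t) (y t)) (t - s) from
    H N le_rfl t hst ht
  intro k
  induction k with
  | zero =>
    intro _ t hst ht
    have : t = s := by linarith
    rw [this, sub_self]
    exact HasPath.refl _ _
  | succ k ih =>
    intro hk t hst ht
    by_cases htk : t ≤ σ k
    · exact ih (by omega) t hst htk
    · push Not at htk
      by_cases hsk : σ k ≤ s
      · exact hedge k hk s ⟨hsk, hst.trans ht⟩ t ⟨htk.le, ht⟩ hst
      · push Not at hsk
        refine ((ih (by omega) (σ k) hsk.le le_rfl).trans (hedge k hk (σ k)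
          ⟨le_rfl, h.mono (Nat.le_succ k)⟩ t ⟨htk.le, ht⟩ htk.le)).mono_weight ?_
        linarith

lemma gweight_comb_le (h : IsTameCurve N σ x y) {s μ : ℝ} (hs : σ 0 ≤ s) (hμ : 0 < μ) (K J : ℕ)
    {Ylo Yhi : ℝ} (hY : Ylo ≤ Yhi) :
    gweight (comb x y s (σ N) μ K J Ylo Yhi) ≤ (K + 1) * (Yhi - Ylo) + (J + 1) * μ := by
  refine (gweight_union_le _ _).trans (add_le_add ?_ ?_)
  · refine (gweight_image_le_card_mul _ _ (ℓ := Yhi - Ylo) fun k _ => ?_).trans (by simp)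
    rw [norm_sub_rev, norm_sub_of_fst_eq (by simp)]
    simp [abs_of_nonneg (sub_nonneg.2 hY)]
  · refine (gweight_image_le_card_mul _ _ (ℓ := μ) fun j hj => ?_).trans ?_
    · rw [Finset.mem_filter] at hj
      have hx := h.x_le hs (le_add_of_nonneg_right (by positivity)) hj.2
      have h1 := floor_mul_le_and_sub_le hμ (sub_nonneg.2 hx)
      rw [norm_sub_rev, norm_sub_of_snd_eq (by simp)]
      simp only [pt_zero]
      rw [abs_of_nonneg (by linarith [h1.1])]
      linarith [h1.2]
    · refine mul_le_mul_of_nonneg_right ?_ hμ.le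
      have := Finset.card_filter_le (Finset.range (J + 1)) fun j : ℕ => s + j * μ ≤ σ N
      rw [Finset.card_range] at this
      exact_mod_cast this

/-- In a comb, points of the curve are joined to columns almost without detour. -/
lemma hasPath_comb (h : IsTameCurve N σ x y) {s μ a Y : ℝ} (hs : σ 0 ≤ s) (hμ : 0 < μ) {K J : ℕ}
    {Ylo Yhi : ℝ} (hsa : s ≤ a) (haN : a ≤ σ N) (haJ : a ≤ s + J * μ) (hxa : x a ≤ x s + K * μ)
    (hlo : Ylo ≤ y a - μ) (hhi : y a + μ ≤ Yhi) (hY1 : Ylo ≤ Y) (hY2 : Y ≤ Yhi) :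
    ∃ k ≤ K, x s + k * μ ≤ x a ∧
      HasPath (comb x y s (σ N) μ K J Ylo Yhi ∪ curveEdges N σ x y) (pt (x s + k * μ) Y)
        (pt (x a) (y a)) (|y a - Y| + 3 * μ) := by
  set j := ⌊(a - s) / μ⌋₊ with hj
  have hj1 := floor_mul_le_and_sub_le hμ (sub_nonneg.2 hsa)
  rw [← hj] at hj1
  set r := s + j * μ with hr
  have hsr : s ≤ r := by
    have : (0 : ℝ) ≤ j * μ := by positivity
    linarith
  have hra : r ≤ a := by linarith [hj1.1]
  have hjJ : j ≤ J := by
    have : (j : ℝ) * μ ≤ J * μ := by linarith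
    exact_mod_cast le_of_mul_le_mul_right this hμ
  have hx1 := h.x_le hs hsr (hra.trans haN)
  have hx2 := h.x_le (hs.trans hsr) hra haN
  have hy := h.sub_add_abs_sub_le (hs.trans hsr) hra haN
  set k := ⌊(x r - x s) / μ⌋₊ with hk
  have hk1 := floor_mul_le_and_sub_le hμ (sub_nonneg.2 hx1)
  rw [← hk] at hk1
  have hkK : k ≤ K := by
    have : (k : ℝ) * μ ≤ K * μ := by linarith
    exact_mod_cast le_of_mul_le_mul_right this hμ
  have hyr : |y a - y r| ≤ μ := by linarith [hj1.2]
  obtain ⟨hy1, hy2⟩ := abs_le.1 hyr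
  refine ⟨k, hkK, by linarith, ?_⟩
  have p1 : HasPath (comb x y s (σ N) μ K J Ylo Yhi) (pt (x s + k * μ) Y) (pt (x s + k * μ) (y r))
      |Y - y r| := by
    refine HasPath.vertical (y₁ := Ylo) (y₂ := Yhi) ?_ hY1 hY2 (by linarith) (by linarith)
    exact Finset.mem_union_left _ (Finset.mem_image.2 ⟨k, Finset.mem_range.2 (by omega), rfl⟩)
  have p2 : HasPath (comb x y s (σ N) μ K J Ylo Yhi) (pt (x s + k * μ) (y r)) (pt (x r) (y r))
      |x s + k * μ - x r| := by
    refine HasPath.horizontal (x₁ := x s + k * μ) (x₂ := x r) ?_ le_rfl (by linarith)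
      (by linarith) le_rfl
    refine Finset.mem_union_right _ (Finset.mem_image.2 ⟨j, ?_, rfl⟩)
    rw [Finset.mem_filter]
    exact ⟨Finset.mem_range.2 (by omega), by linarith⟩
  have p3 := h.hasPath_arc (hs.trans hsr) hra haN
  refine (((p1.mono Finset.subset_union_left).trans (p2.mono Finset.subset_union_left)).trans
    (p3.mono Finset.subset_union_right)).mono_weight ?_
  have e1 : |Y - y r| ≤ |y a - Y| + |y a - y r| := by
    rw [abs_sub_comm (y a) Y]
    exact abs_sub_le Y (y a) (y r)
  have e2 : |x s + k * μ - x r| ≤ μ - 0 := by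
    rw [abs_le]; constructor <;> linarith [hk1.1, hk1.2]
  have e3 := abs_nonneg (y a - y r)
  linarith [hj1.2]

end IsTameCurve

/-- A shallow-light tree of depth `K` from the root `(x₀, y₀)` to the horizontal segment of length
`D` at height `y₀ + H` whose left endpoint lies vertically above (or below) the root. -/
def shallowLightTree : ℕ → ℝ → ℝ → ℝ → ℝ → Finset (Plane × Plane)
  | 0, x₀, y₀, _, H => {(pt x₀ y₀, pt x₀ (y₀ + H))}
  | K + 1, x₀, y₀, D, H =>
    {(pt x₀ y₀, pt x₀ (y₀ + 2 * H / 3)), (pt x₀ y₀, pt (x₀ + D / 2) (y₀ + 2 * H / 3))} ∪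
      (shallowLightTree K x₀ (y₀ + 2 * H / 3) (D / 2) (H / 3) ∪
        shallowLightTree K (x₀ + D / 2) (y₀ + 2 * H / 3) (D / 2) (H / 3))

lemma gweight_shallowLightTree_le (K : ℕ) : ∀ (x₀ y₀ D H : ℝ), 0 ≤ D →
    gweight (shallowLightTree K x₀ y₀ D H) ≤ 4 * |H| + K * (D / 2) := by
  induction K with
  | zero =>
    intro x₀ y₀ D H hD
    rw [shallowLightTree, gweight_singleton, norm_sub_of_fst_eq (by simp)]
    simp
    linarith [abs_nonneg H]
  | succ K ih =>
    intro x₀ y₀ D H hD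
    have h1 := ih x₀ (y₀ + 2 * H / 3) (D / 2) (H / 3) (by linarith)
    have h2 := ih (x₀ + D / 2) (y₀ + 2 * H / 3) (D / 2) (H / 3) (by linarith)
    have e1 : |H / 3| = |H| / 3 := by rw [abs_div]; norm_num
    have e2 : |2 * H / 3| = 2 * |H| / 3 := by rw [abs_div, abs_mul]; norm_num
    have hD2 : |D / 2| = D / 2 := abs_of_nonneg (by linarith)
    have h3 : gweight {(pt x₀ y₀, pt x₀ (y₀ + 2 * H / 3)),
        (pt x₀ y₀, pt (x₀ + D / 2) (y₀ + 2 * H / 3))} ≤ 2 * |H| / 3 + (D / 2 + 2 * |H| / 3) := by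
      rw [Finset.insert_eq]
      refine (gweight_union_le _ _).trans (add_le_add ?_ ?_)
      · rw [gweight_singleton]
        refine (norm_sub_le_abs_add_abs _ _).trans (le_of_eq ?_)
        simp [e2]
      · rw [gweight_singleton]
        refine (norm_sub_le_abs_add_abs _ _).trans (le_of_eq ?_)
        simp [e2, hD2]
    rw [e1] at h1 h2
    rw [shallowLightTree]
    refine (gweight_union_le _ _).trans ((add_le_add h3 (gweight_union_le _ _)).trans ?_)
    push_cast
    linarith

lemma hasPath_shallowLightTree (K : ℕ) : ∀ (x₀ y₀ D H : ℝ) (F : Finset (Plane × Plane))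
    (xa xb Y x : ℝ), 0 ≤ D → H ≠ 0 → shallowLightTree K x₀ y₀ D H ⊆ F →
    (pt xa Y, pt xb Y) ∈ F → Y = y₀ + H → xa ≤ x₀ → x₀ + D ≤ xb → x₀ ≤ x → x ≤ x₀ + D →
    HasPath F (pt x₀ y₀) (pt x Y) (|H| + 3 / 4 * D ^ 2 / |H| + D / 2 ^ K) := by
  induction K with
  | zero =>
    intro x₀ y₀ D H F xa xb Y x hD hH hF hY hYH hxa hxb hx1 hx2
    have p1 : HasPath F (pt x₀ y₀) (pt x₀ Y) |H| := by
      refine (HasPath.of_edge (hF ?_)).mono_weight (le_of_eq ?_)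
      · simp [shallowLightTree, hYH]
      · rw [norm_sub_of_fst_eq (by simp)]
        simp [hYH]
    have p2 : HasPath F (pt x₀ Y) (pt x Y) |x₀ - x| :=
      HasPath.horizontal hY hxa (by linarith) (by linarith) (by linarith)
    refine (p1.trans p2).mono_weight ?_
    have e1 : |x₀ - x| ≤ D := by rw [abs_le]; constructor <;> linarith
    have e2 : 0 ≤ 3 / 4 * D ^ 2 / |H| := by positivity
    simp only [pow_zero, div_one]
    linarith
  | succ K ih =>
    intro x₀ y₀ D H F xa xb Y x hD hH hF hY hYH hxa hxb hx1 hx2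
    have hHpos : 0 < |H| := abs_pos.2 hH
    have e1 : |H / 3| = |H| / 3 := by rw [abs_div]; norm_num
    have e2 : |2 * H / 3| = 2 * |H| / 3 := by rw [abs_div, abs_mul]; norm_num
    rw [shallowLightTree] at hF
    have hF1 := (Finset.union_subset_iff.1 hF).1
    have hF2 := (Finset.union_subset_iff.1 (Finset.union_subset_iff.1 hF).2).1
    have hF3 := (Finset.union_subset_iff.1 (Finset.union_subset_iff.1 hF).2).2
    have hsum : 2 * |H| / 3 + 3 / 16 * D ^ 2 / |H| +
        (|H / 3| + 3 / 4 * (D / 2) ^ 2 / |H / 3| + D / 2 / 2 ^ K) =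
        |H| + 3 / 4 * D ^ 2 / |H| + D / 2 ^ (K + 1) := by
      rw [e1, pow_succ]
      field_simp
      ring
    rw [← hsum]
    rcases le_total x (x₀ + D / 2) with hx | hx
    · refine HasPath.trans (b := pt x₀ (y₀ + 2 * H / 3)) ?_
        (ih _ _ _ _ F xa xb Y x (by linarith) (by simpa using hH) hF2 hY (by linarith) hxa
          (by linarith) hx1 hx)
      refine (HasPath.of_edge (hF1 (by simp))).mono_weight ?_
      rw [norm_sub_of_fst_eq (by simp)]
      have : 0 ≤ 3 / 16 * D ^ 2 / |H| := by positivity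
      simp [e2]
      linarith
    · refine HasPath.trans (b := pt (x₀ + D / 2) (y₀ + 2 * H / 3)) ?_
        (ih _ _ _ _ F xa xb Y x (by linarith) (by simpa using hH) hF3 hY (by linarith)
          (by linarith) (by linarith) hx (by linarith))
      refine (HasPath.of_edge (hF1 (by simp))).mono_weight ?_
      refine norm_sub_le_height_add (d := D / 2) (by positivity) (by simp [e2])
        (by simp [abs_of_nonneg (show 0 ≤ D / 2 by linarith)]) (le_of_eq ?_)
      field_simp
      ring

namespace IsTameCurve

variable {N : ℕ} {σ : ℕ → ℝ} {x y : ℝ → ℝ}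

set_option maxHeartbeats 1000000 in
/-- A spanner between the base line and a cluster of nodes of comparable heights. -/
lemma exists_cluster_base_spanner (h : IsTameCurve N σ x y) {θ : ℝ} (hθ0 : 0 < θ) (hθ1 : θ ≤ 1)
    {y₀ H : ℝ} (hH : 0 < H) {i r : ℕ} (hir : i ≤ r) (hr : r ≤ N) (hi : y (σ i) = y₀ + H)
    (hlo : ∀ k, i ≤ k → k ≤ r → y₀ + H / 2 ≤ y (σ k))
    (hhi : ∀ k, i ≤ k → k ≤ r → y (σ k) ≤ y₀ + 2 * H)
    (hx : ∀ k, i ≤ k → k ≤ r → x (σ k) ≤ x (σ i) + θ * H) :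
    ∃ E : Finset (Plane × Plane), gweight E ≤ 30 * (H + (σ r - σ i) / θ) ∧
      ∀ k, i ≤ k → k ≤ r → ∀ X, |x (σ k) - X| ≤ θ * (y (σ k) - y₀) →
        HasPath (E ∪ curveEdges N σ x y) (pt X y₀) (pt (x (σ k)) (y (σ k)))
          ((1 + 480 * θ ^ 2) * (y (σ k) - y₀)) := by
  obtain ⟨K, hK1, hK2⟩ : ∃ K : ℕ, 8 / θ ≤ K ∧ (K : ℝ) ≤ 9 / θ := by
    refine ⟨⌈8 / θ⌉₊, Nat.le_ceil _, (Nat.ceil_lt_add_one (by positivity)).le.trans ?_⟩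
    rw [div_add_one hθ0.ne']
    gcongr
    linarith
  obtain ⟨d, hd1, hd2⟩ : ∃ d : ℕ, 1 / θ ≤ 2 ^ d ∧ (d : ℝ) ≤ 2 / θ := by
    refine ⟨⌈1 / θ⌉₊, (Nat.le_ceil _).trans ?_,
      (Nat.ceil_lt_add_one (by positivity)).le.trans ?_⟩
    · exact_mod_cast (Nat.lt_two_pow_self (n := ⌈1 / θ⌉₊)).le
    · rw [div_add_one hθ0.ne']
      gcongr
      linarith
  rw [div_le_iff₀ hθ0] at hK1 hd1
  rw [le_div_iff₀ hθ0] at hK2 hd2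
  have hKpos : (0 : ℝ) < K := by
    by_contra hneg
    push Not at hneg
    nlinarith
  obtain ⟨μ, hKμ⟩ : ∃ μ : ℝ, K * μ = θ * H := ⟨θ * H / K, by field_simp⟩
  have hμ : 0 < μ := by
    have : 0 < K * μ := by rw [hKμ]; positivity
    exact pos_of_mul_pos_right this hKpos.le
  have hμ8 : 8 * μ ≤ θ ^ 2 * H := by
    have : 8 * μ ≤ K * θ * μ := mul_le_mul_of_nonneg_right hK1 hμ.le
    nlinarith
  have hθ2 : θ ^ 2 ≤ 1 := by nlinarith
  have hμH : 8 * μ ≤ H := hμ8.trans (by nlinarith)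
  set len := σ r - σ i with hlen
  have hlen0 : 0 ≤ len := sub_nonneg.2 (h.mono hir)
  obtain ⟨J, hJ1, hJ2⟩ : ∃ J : ℕ, len ≤ J * μ ∧ J * μ ≤ len + μ := by
    refine ⟨⌈len / μ⌉₊, ?_, ?_⟩
    · have := Nat.le_ceil (len / μ)
      rwa [div_le_iff₀ hμ] at this
    · have := (Nat.ceil_lt_add_one (div_nonneg hlen0 hμ.le)).le
      rw [div_add_one hμ.ne', le_div_iff₀ hμ] at this
      exact this
  obtain ⟨ylo, hylo1, hylo2, hylo3, hylo4⟩ : ∃ ylo, y₀ + H / 2 ≤ ylo ∧ ylo ≤ y (σ i) ∧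
      y (σ i) - len ≤ ylo ∧ ∀ k, i ≤ k → k ≤ r → ylo ≤ y (σ k) := by
    refine ⟨max (y₀ + H / 2) (y (σ i) - len), le_max_left _ _,
      max_le (by linarith) (by linarith), le_max_right _ _, fun k hk1 hk2 =>
      max_le (hlo k hk1 hk2) ?_⟩
    have h1 := h.sub_add_abs_sub_le (h.node_mem (hir.trans hr)).1 (h.mono hk1)
      (h.mono (hk2.trans hr))
    have h2 := h.x_le (h.node_mem (hir.trans hr)).1 (h.mono hk1) (h.mono (hk2.trans hr))
    have h3 := h.mono hk2
    have h4 := neg_abs_le (y (σ k) - y (σ i))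
    linarith
  have hi0 := (h.node_mem (hir.trans hr)).1
  set x₀ := x (σ i) - 2 * (θ * H) with hx₀
  set D := 5 * (θ * H) with hD
  have hθH : 0 < θ * H := by positivity
  set T₁ := shallowLightTree d x₀ (y₀ + H / 4) D (-(H / 4)) with hT₁
  set T₂ := shallowLightTree d x₀ (y₀ + H / 4) D (ylo - μ - (y₀ + H / 4)) with hT₂
  set G := comb x y (σ i) (σ N) μ K J (ylo - μ) (y (σ i) + len + μ) with hG
  set B : Finset (Plane × Plane) :=
    {(pt x₀ y₀, pt (x₀ + D) y₀), (pt x₀ (ylo - μ), pt (x₀ + D) (ylo - μ))} with hB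
  have hup : 0 < ylo - μ - (y₀ + H / 4) := by linarith
  have hup2 : ylo - μ - (y₀ + H / 4) ≤ H := by linarith
  have hdD : d * (D / 2) ≤ 5 * H := by rw [hD]; nlinarith
  refine ⟨T₁ ∪ T₂ ∪ G ∪ B, ?_, ?_⟩
  · have w1 := gweight_shallowLightTree_le d x₀ (y₀ + H / 4) D (-(H / 4)) (by positivity)
    have w2 := gweight_shallowLightTree_le d x₀ (y₀ + H / 4) D (ylo - μ - (y₀ + H / 4))
      (by positivity)
    have w3 := h.gweight_comb_le hi0 hμ K J
      (by linarith : ylo - μ ≤ y (σ i) + len + μ)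
    have w4 : gweight B ≤ D + D := by
      rw [hB, Finset.insert_eq]
      refine (gweight_union_le _ _).trans (add_le_add ?_ ?_) <;>
      · rw [gweight_singleton, norm_sub_of_snd_eq (by simp)]
        simp [abs_of_pos (show 0 < D by positivity)]
    rw [abs_neg, abs_of_pos (by positivity)] at w1
    rw [abs_of_pos hup] at w2
    have w5 : (K + 1) * (y (σ i) + len + μ - (ylo - μ)) ≤ 20 * (len / θ) + 5 * H := by
      have e1 : y (σ i) + len + μ - (ylo - μ) ≤ 2 * len + 2 * μ := by linarith
      have e2 : (K + 1 : ℝ) * (y (σ i) + len + μ - (ylo - μ)) ≤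
          (K + 1) * (2 * len + 2 * μ) := by gcongr
      have e3 : (K : ℝ) + 1 ≤ 10 / θ := by
        rw [le_div_iff₀ hθ0]; linarith
      have e4 : (K + 1 : ℝ) * (2 * len) ≤ 10 / θ * (2 * len) := by gcongr
      have e5 : 10 / θ * (2 * len) = 20 * (len / θ) := by ring
      nlinarith
    have w6 : (J + 1) * μ ≤ len / θ + H := by
      have : len ≤ len / θ := by
        rw [le_div_iff₀ hθ0]; nlinarith
      linarith
    have hlθ : 0 ≤ len / θ := by positivity
    have hDH : D ≤ 5 * H := by rw [hD]; nlinarith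
    refine (gweight_union_le _ _).trans ?_
    refine (add_le_add_left ((gweight_union_le _ _).trans (add_le_add_left
      (gweight_union_le _ _) _)) _).trans ?_
    linarith
  · intro k hk1 hk2 X hX
    have hkN := hk2.trans hr
    have hX' := abs_le.1 hX
    have hxk1 := h.x_le hi0 (h.mono hk1) (h.mono hkN)
    have hxk2 := hx k hk1 hk2
    have hyk1 := hlo k hk1 hk2
    have hyk2 := hhi k hk1 hk2
    have hyk : θ * (y (σ k) - y₀) ≤ 2 * (θ * H) := by nlinarith
    have hyk3 := h.sub_add_abs_sub_le hi0 (h.mono hk1) (h.mono hkN)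
    have hkr := h.mono hk2
    have hyk4 := le_abs_self (y (σ k) - y (σ i))
    obtain ⟨c, hcK, hcx, hc⟩ := h.hasPath_comb hi0 hμ (K := K) (J := J) (a := σ k)
      (Ylo := ylo - μ) (Yhi := y (σ i) + len + μ) (Y := ylo - μ) (h.mono hk1) (h.mono hkN)
      (by linarith) (by linarith) (by linarith [hylo4 k hk1 hk2]) (by linarith) le_rfl
      (by linarith)
    have hc0 : (0 : ℝ) ≤ c * μ := by positivity
    have hdpow : D / 2 ^ d ≤ 5 * (θ ^ 2 * H) := by
      rw [div_le_iff₀ (by positivity), hD]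
      have : θ * H * 1 ≤ θ * H * (2 ^ d * θ) := mul_le_mul_of_nonneg_left hd1 hθH.le
      nlinarith
    have p1 := hasPath_shallowLightTree d x₀ (y₀ + H / 4) D (-(H / 4))
      (T₁ ∪ T₂ ∪ G ∪ B ∪ curveEdges N σ x y) x₀ (x₀ + D) y₀ X (by positivity) (by linarith)
      (fun e he => by simp only [Finset.mem_union]; tauto) (by simp [hB]) (by ring) le_rfl le_rfl
      (by linarith) (by linarith)
    have p2 := hasPath_shallowLightTree d x₀ (y₀ + H / 4) D (ylo - μ - (y₀ + H / 4))
      (T₁ ∪ T₂ ∪ G ∪ B ∪ curveEdges N σ x y) x₀ (x₀ + D) (ylo - μ) (x (σ i) + c * μ)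
      (by positivity) hup.ne'
      (fun e he => by simp only [Finset.mem_union]; tauto) (by simp [hB]) (by ring) le_rfl le_rfl
      (by linarith) (by linarith)
    have p3 := hc.mono (F := T₁ ∪ T₂ ∪ G ∪ B ∪ curveEdges N σ x y)
      (fun e he => by simp only [Finset.mem_union] at he ⊢; tauto)
    refine ((p1.symm.trans p2).trans p3).mono_weight ?_
    rw [abs_neg, abs_of_pos (by positivity : 0 < H / 4), abs_of_pos hup,
      abs_of_nonneg (by linarith [hylo4 k hk1 hk2])]
    have e1 : 3 / 4 * D ^ 2 / (H / 4) = 75 * (θ ^ 2 * H) := by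
      rw [hD]; field_simp; ring
    have e2 : 3 / 4 * D ^ 2 / (ylo - μ - (y₀ + H / 4)) ≤ 150 * (θ ^ 2 * H) := by
      rw [div_le_iff₀ hup, hD]
      have : H / 8 ≤ ylo - μ - (y₀ + H / 4) := by linarith
      have := mul_le_mul_of_nonneg_left this (by positivity : 0 ≤ 150 * (θ ^ 2 * H))
      nlinarith
    have e3 : θ ^ 2 * H ≤ θ ^ 2 * (2 * (y (σ k) - y₀)) := by gcongr; linarith
    rw [e1]
    linarith

/-- A spanner between the base line and the nodes of the curve. -/
lemma exists_base_spanner (h : IsTameCurve N σ x y) {θ : ℝ} (hθ0 : 0 < θ) (hθ1 : θ ≤ 1)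
    {y₀ : ℝ} (hy₀ : ∀ i ≤ N, y₀ ≤ y (σ i)) (hN : y (σ N) = y₀) :
    ∃ E : Finset (Plane × Plane), gweight E ≤ 90 * ((σ N - σ 0) / θ) ∧
      ∀ k ≤ N, ∀ X, |x (σ k) - X| ≤ θ * (y (σ k) - y₀) →
        HasPath (E ∪ curveEdges N σ x y) (pt X y₀) (pt (x (σ k)) (y (σ k)))
          ((1 + 480 * θ ^ 2) * (y (σ k) - y₀)) := by
  suffices H : ∀ m i, i ≤ N → N - i = m →
      ∃ E : Finset (Plane × Plane), gweight E ≤ 90 * ((σ N - σ i) / θ) ∧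
      ∀ k ≤ N, i ≤ k → ∀ X, |x (σ k) - X| ≤ θ * (y (σ k) - y₀) →
        HasPath (E ∪ curveEdges N σ x y) (pt X y₀) (pt (x (σ k)) (y (σ k)))
          ((1 + 480 * θ ^ 2) * (y (σ k) - y₀)) by
    obtain ⟨E, h1, h2⟩ := H N 0 (Nat.zero_le N) (Nat.sub_zero N)
    exact ⟨E, h1, fun k hk => h2 k hk (Nat.zero_le k)⟩
  have htriv : ∀ (F : Finset (Plane × Plane)) k, y (σ k) = y₀ →
      ∀ X, |x (σ k) - X| ≤ θ * (y (σ k) - y₀) → HasPath F (pt X y₀) (pt (x (σ k)) (y (σ k)))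
        ((1 + 480 * θ ^ 2) * (y (σ k) - y₀)) := by
    intro F k hk X hX
    rw [hk, sub_self, mul_zero] at hX ⊢
    rw [sub_eq_zero.1 (abs_nonpos_iff.1 hX)]
    exact HasPath.refl _ _
  intro m
  induction m using Nat.strong_induction_on with
  | _ m ih =>
  intro i hi him
  by_cases hyi : y (σ i) = y₀
  · rcases hi.eq_or_lt with rfl | hlt
    · refine ⟨∅, by simp [gweight_empty], fun k hk1 hk2 => ?_⟩
      rw [le_antisymm hk1 hk2]
      exact htriv _ _ hyi
    · obtain ⟨E, h1, h2⟩ := ih (N - (i + 1)) (by omega) (i + 1) hlt rfl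
      refine ⟨E, h1.trans ?_, fun k hk1 hk2 => ?_⟩
      · have := h.mono (Nat.le_succ i)
        gcongr
      · rcases hk2.eq_or_lt with rfl | hk
        · exact htriv _ _ hyi
        · exact h2 k hk1 hk
  · have hpos : 0 < y (σ i) - y₀ := by
      have := lt_of_le_of_ne (hy₀ i hi) (Ne.symm hyi)
      linarith
    set H := y (σ i) - y₀ with hH
    have hex : ∃ k, i ≤ k ∧ k ≤ N ∧ ¬ (y₀ + H / 2 ≤ y (σ k) ∧ y (σ k) ≤ y₀ + 2 * H ∧
        x (σ k) ≤ x (σ i) + θ * H) :=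
      ⟨N, hi, le_rfl, fun hc => by linarith [hc.1]⟩
    obtain ⟨hr1, hr2, hr3⟩ := Nat.find_spec hex
    have hmin := fun k hk => Nat.find_min hex (m := k) hk
    set r := Nat.find hex with hr
    have hir : i < r := by
      rcases hr1.eq_or_lt with heq | hlt
      · exfalso
        rw [← heq] at hr3
        exact hr3 ⟨by linarith, by linarith, by nlinarith⟩
      · exact hlt
    have hin : ∀ k, i ≤ k → k ≤ r - 1 → y₀ + H / 2 ≤ y (σ k) ∧ y (σ k) ≤ y₀ + 2 * H ∧
        x (σ k) ≤ x (σ i) + θ * H := by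
      intro k hk1 hk2
      by_contra hc
      exact hmin k (by omega) ⟨hk1, by omega, hc⟩
    obtain ⟨E₁, hE₁, hE₁'⟩ := h.exists_cluster_base_spanner hθ0 hθ1 hpos
      (by omega : i ≤ r - 1) (by omega) (by linarith : y (σ i) = y₀ + H)
      (fun k h1 h2 => (hin k h1 h2).1) (fun k h1 h2 => (hin k h1 h2).2.1)
      (fun k h1 h2 => (hin k h1 h2).2.2)
    obtain ⟨E₂, hE₂, hE₂'⟩ := ih (N - r) (by omega) r hr2 rfl
    refine ⟨E₁ ∪ E₂, ?_, fun k hk1 hk2 X hX => ?_⟩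
    · have hi0 := (h.node_mem hi).1
      have g1 := h.sub_add_abs_sub_le hi0 (h.mono hir.le) (h.mono hr2)
      have g2 := h.x_le hi0 (h.mono hir.le) (h.mono hr2)
      have g3 := h.mono (show r - 1 ≤ r by omega)
      have hgap : H ≤ 2 * ((σ r - σ i) / θ) := by
        rw [mul_div_assoc', le_div_iff₀ hθ0]
        have g4 := abs_le.1 (show |y (σ r) - y (σ i)| ≤ σ r - σ i by linarith)
        have g5 : H * θ ≤ H := by nlinarith
        by_cases c1 : y₀ + H / 2 ≤ y (σ r)
        · by_cases c2 : y (σ r) ≤ y₀ + 2 * H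
          · have c3 : ¬ x (σ r) ≤ x (σ i) + θ * H := fun c3 => hr3 ⟨c1, c2, c3⟩
            push Not at c3
            linarith [abs_nonneg (y (σ r) - y (σ i))]
          · linarith
        · linarith
      have hlen : (σ (r - 1) - σ i) / θ ≤ (σ r - σ i) / θ := by gcongr
      have hsum : (σ N - σ i) / θ = (σ N - σ r) / θ + (σ r - σ i) / θ := by ring
      refine (gweight_union_le _ _).trans ?_
      rw [hsum]
      linarith
    · rcases lt_or_ge k r with hkr | hkr
      · exact (hE₁' k hk2 (by omega) X hX).mono
          (Finset.union_subset_union_left Finset.subset_union_left)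
      · exact (hE₂' k hk1 hkr X hX).mono
          (Finset.union_subset_union_left Finset.subset_union_right)

end IsTameCurve

/-! ### Charging pools to records -/

/-- `k` is a strict record of `F` on `[b, k]`. -/
def IsRecord (F : ℕ → ℝ) (b k : ℕ) : Prop := b ≤ k ∧ ∀ j, b ≤ j → j < k → F j < F k

/-- The first maximum of `F` on `[b, c]` is a record. -/
lemma exists_isRecord_forall_le (F : ℕ → ℝ) {b c : ℕ} (hbc : b ≤ c) :
    ∃ P ≤ c, (∀ j, b ≤ j → j ≤ c → F j ≤ F P) ∧ IsRecord F b P := by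
  obtain ⟨M, hM, hMmax⟩ := Finset.exists_max_image (Finset.Icc b c) F
    ⟨b, Finset.mem_Icc.2 ⟨le_rfl, hbc⟩⟩
  have hex : ∃ P, b ≤ P ∧ P ≤ c ∧ F M ≤ F P :=
    ⟨M, (Finset.mem_Icc.1 hM).1, (Finset.mem_Icc.1 hM).2, le_rfl⟩
  obtain ⟨h1, h2, h3⟩ := Nat.find_spec hex
  refine ⟨Nat.find hex, h2, fun j hj1 hj2 =>
    (hMmax j (Finset.mem_Icc.2 ⟨hj1, hj2⟩)).trans h3, h1, fun j hj1 hj2 => ?_⟩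
  by_contra hcon
  push Not at hcon
  exact Nat.find_min hex hj2 ⟨hj1, by omega, h3.trans hcon⟩

/-- The records of `F` on `[b, P]` other than `b`. -/
def recordsIn (F : ℕ → ℝ) (b P : ℕ) : Finset ℕ := (Finset.Ioc b P).filter (IsRecord F b)

lemma sub_le_sum_recordsIn (F : ℕ → ℝ) {b P : ℕ} (hbP : b ≤ P) :
    ∀ j, b ≤ j → j ≤ P → F j - F b ≤ ∑ k ∈ recordsIn F b P, max 0 (F k - F (k - 1)) := by
  induction P, hbP using Nat.le_induction with
  | base =>
    intro j h1 h2
    rw [le_antisymm h2 h1, sub_self]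
    exact Finset.sum_nonneg fun k _ => le_max_left _ _
  | succ P hbP ih =>
    have hins : Finset.Ioc b (P + 1) = insert (P + 1) (Finset.Ioc b P) := by
      ext k; simp only [Finset.mem_Ioc, Finset.mem_insert]; omega
    have hnot : P + 1 ∉ recordsIn F b P := by simp [recordsIn]
    by_cases hrec : IsRecord F b (P + 1)
    · have hset : recordsIn F b (P + 1) = insert (P + 1) (recordsIn F b P) := by
        rw [recordsIn, hins, Finset.filter_insert, if_pos hrec, recordsIn]
      rw [hset, Finset.sum_insert hnot, Nat.add_sub_cancel]
      intro j h1 h2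
      rcases h2.eq_or_lt with rfl | hlt
      · have := ih P hbP le_rfl
        linarith [le_max_right 0 (F (P + 1) - F P)]
      · have := ih j h1 (by omega)
        linarith [le_max_left 0 (F (P + 1) - F P)]
    · have hset : recordsIn F b (P + 1) = recordsIn F b P := by
        rw [recordsIn, hins, Finset.filter_insert, if_neg hrec, recordsIn]
      rw [hset]
      intro j h1 h2
      rcases h2.eq_or_lt with rfl | hlt
      · have : ∃ i, b ≤ i ∧ i < P + 1 ∧ F (P + 1) ≤ F i := by
          by_contra hcon
          push Not at hcon
          exact hrec ⟨h1, hcon⟩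
        obtain ⟨i, hi1, hi2, hi3⟩ := this
        have := ih i hi1 (by omega)
        linarith
      · exact ih j h1 (by omega)

lemma sum_sub_le_of_nonoverlapping {N : ℕ} {X : ℕ → ℝ}
    (hX : ∀ i j, i ≤ j → j ≤ N → X i ≤ X j) (e : ℕ → ℕ) (A : Finset ℕ) :
    ∀ b c, b ≤ c → c ≤ N → (∀ P ∈ A, b ≤ P ∧ P ≤ e P ∧ e P ≤ c) →
      (∀ P ∈ A, ∀ Q ∈ A, P < Q → e P ≤ Q) → ∑ P ∈ A, (X (e P) - X P) ≤ X c - X b := by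
  induction A using Finset.induction_on_max with
  | empty =>
    intro b c hbc hc _ _
    simpa using hX b c hbc hc
  | insert a s hmax ih =>
    intro b c hbc hc h1 h2
    have ha : a ∉ s := fun h => lt_irrefl a (hmax a h)
    obtain ⟨ha1, ha2, ha3⟩ := h1 a (Finset.mem_insert_self a s)
    rw [Finset.sum_insert ha]
    have hs := ih b a ha1 (by omega)
      (fun P hP => ⟨(h1 P (Finset.mem_insert_of_mem hP)).1,
        (h1 P (Finset.mem_insert_of_mem hP)).2.1,
        h2 P (Finset.mem_insert_of_mem hP) a (Finset.mem_insert_self a s) (hmax P hP)⟩)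
      (fun P hP Q hQ => h2 P (Finset.mem_insert_of_mem hP) Q (Finset.mem_insert_of_mem hQ))
    linarith [hX (e a) c ha3 hc]

/-- The total width of the pools is bounded by the total ascent of `F`. -/
lemma sum_pool_width_le {N : ℕ} {F X : ℕ → ℝ} (hX : ∀ i j, i ≤ j → j ≤ N → X i ≤ X j)
    {s e : ℕ → ℕ} (hPe : ∀ P ≤ N, P ≤ e P) (heN : ∀ P ≤ N, e P ≤ N)
    (hrec : ∀ P ≤ N, IsRecord F (s P) P) (hpool : ∀ P ≤ N, ∀ j, P ≤ j → j ≤ e P → F j ≤ F P)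
    (hkey : ∀ P ≤ N, X (e P) - X (s P) ≤ F P - F (s P)) :
    ∑ P ∈ Finset.range (N + 1), (X (e P) - X P) ≤
      ∑ k ∈ Finset.range N, max 0 (F (k + 1) - F k) := by
  set Z : ℕ → Finset ℕ := fun P => recordsIn F (s P) P with hZ
  have hclaim : ∀ m, ∀ T : Finset ℕ, T.card = m → T ⊆ Finset.range (N + 1) →
      ∑ P ∈ T, (X (e P) - X P) ≤ ∑ k ∈ T.biUnion Z, max 0 (F k - F (k - 1)) := by
    intro m
    induction m using Nat.strong_induction_on with
    | _ m ih =>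
    intro T hTm hTN
    rcases T.eq_empty_or_nonempty with rfl | hne
    · simp
    obtain ⟨P, hPT, hPmax⟩ : ∃ P ∈ T, ∀ Q ∈ T, Q ≤ P :=
      ⟨T.max' hne, T.max'_mem hne, fun Q hQ => T.le_max' Q hQ⟩
    have hTN' : ∀ Q ∈ T, Q ≤ N := fun Q hQ => by
      have := Finset.mem_range.1 (hTN hQ)
      omega
    set p : ℕ → Prop := fun Q => Q ≠ P ∧ Disjoint (Z Q) (Z P) with hp
    have hlt : (T.filter p).card < m := by
      rw [← hTm]
      exact Finset.card_lt_card (Finset.filter_ssubset.2 ⟨P, hPT, by simp [hp]⟩)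
    have h1 := ih _ hlt (T.filter p) rfl ((Finset.filter_subset _ _).trans hTN)
    have hrecP : ∀ Q ∈ T.filter (fun Q => ¬ p Q), IsRecord F (s P) Q := by
      intro Q hQ
      obtain ⟨hQT, hQp⟩ := Finset.mem_filter.1 hQ
      by_cases hQP : Q = P
      · rw [hQP]
        exact hrec P (hTN' P hPT)
      · have hnd : ¬ Disjoint (Z Q) (Z P) := fun hd => hQp ⟨hQP, hd⟩
        rw [Finset.not_disjoint_iff] at hnd
        obtain ⟨z, hzQ, hzP⟩ := hnd
        simp only [hZ, recordsIn, Finset.mem_filter, Finset.mem_Ioc] at hzQ hzP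
        obtain ⟨⟨hz1, hz2⟩, hz3⟩ := hzQ
        obtain ⟨⟨hz4, hz5⟩, hz6⟩ := hzP
        have hQ2 := (hrec Q (hTN' Q hQT)).2
        refine ⟨by omega, fun j hj1 hj2 => ?_⟩
        rcases lt_or_ge j z with hjz | hjz
        · have := hz6.2 j hj1 hjz
          rcases hz2.eq_or_lt with rfl | hzQ'
          · exact this
          · exact this.trans (hQ2 z hz1.le hzQ')
        · exact hQ2 j (by omega) hj2
    have h2 : ∑ Q ∈ T.filter (fun Q => ¬ p Q), (X (e Q) - X Q) ≤ X (e P) - X (s P) := by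
      have hsep : ∀ Q ∈ T.filter (fun Q => ¬ p Q), ∀ R ∈ T.filter (fun Q => ¬ p Q),
          Q < R → e Q ≤ R := by
        intro Q hQ R hR hQR
        by_contra hcon
        push Not at hcon
        have hQN := hTN' Q (Finset.mem_filter.1 hQ).1
        have e1 := hpool Q hQN R hQR.le hcon.le
        have e2 := (hrecP R hR).2 Q (hrecP Q hQ).1 hQR
        linarith
      have hPmem : P ∈ T.filter (fun Q => ¬ p Q) := by simp [hp, hPT]
      refine sum_sub_le_of_nonoverlapping hX e _ (s P) (e P)
        ((hrec P (hTN' P hPT)).1.trans (hPe P (hTN' P hPT))) (heN P (hTN' P hPT)) ?_ hsep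
      intro Q hQ
      have hQT := (Finset.mem_filter.1 hQ).1
      refine ⟨(hrecP Q hQ).1, hPe Q (hTN' Q hQT), ?_⟩
      rcases (hPmax Q hQT).eq_or_lt with rfl | hQP
      · exact le_rfl
      · exact (hsep Q hQ P hPmem hQP).trans (hPe P (hTN' P hPT))
    have h3 := hkey P (hTN' P hPT)
    have h4 := sub_le_sum_recordsIn F (hrec P (hTN' P hPT)).1 P (hrec P (hTN' P hPT)).1 le_rfl
    have hdisj : Disjoint ((T.filter p).biUnion Z) (Z P) := by
      rw [Finset.disjoint_biUnion_left]
      intro Q hQ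
      exact (Finset.mem_filter.1 hQ).2.2
    have hsub : (T.filter p).biUnion Z ∪ Z P ⊆ T.biUnion Z :=
      Finset.union_subset (Finset.biUnion_subset_biUnion_of_subset_left Z
        (Finset.filter_subset _ _)) (Finset.subset_biUnion_of_mem Z hPT)
    rw [← Finset.sum_filter_add_sum_filter_not T p]
    calc _ ≤ ∑ k ∈ (T.filter p).biUnion Z, max 0 (F k - F (k - 1)) +
          ∑ k ∈ Z P, max 0 (F k - F (k - 1)) := by linarith
      _ = ∑ k ∈ (T.filter p).biUnion Z ∪ Z P, max 0 (F k - F (k - 1)) :=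
          (Finset.sum_union hdisj).symm
      _ ≤ _ := Finset.sum_le_sum_of_subset_of_nonneg hsub fun k _ _ => le_max_left _ _
  refine (hclaim _ (Finset.range (N + 1)) rfl Finset.Subset.rfl).trans ?_
  have himg : ∑ k ∈ Finset.range N, max 0 (F (k + 1) - F k) =
      ∑ k ∈ (Finset.range N).image Nat.succ, max 0 (F k - F (k - 1)) := by
    rw [Finset.sum_image fun a _ b _ hab => Nat.succ_injective hab]
    simp
  rw [himg]
  refine Finset.sum_le_sum_of_subset_of_nonneg ?_ fun k _ _ => le_max_left _ _
  intro k hk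
  obtain ⟨P, hP, hkP⟩ := Finset.mem_biUnion.1 hk
  rw [Finset.mem_range] at hP
  simp only [hZ, recordsIn, Finset.mem_filter, Finset.mem_Ioc] at hkP
  exact Finset.mem_image.2 ⟨k - 1, Finset.mem_range.2 (by omega), by simp; omega⟩

/-! ### Highways along the curve -/

/-- The tilted height `3θy - 2x` at the nodes. -/
def tilt (σ : ℕ → ℝ) (x y : ℝ → ℝ) (θ : ℝ) (k : ℕ) : ℝ := 3 * θ * y (σ k) - 2 * x (σ k)

/-- The curve from node `b` to node `c` stays in the steep cone with apex `b`. -/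
def InCone (σ : ℕ → ℝ) (x y : ℝ → ℝ) (θ : ℝ) (b c : ℕ) : Prop :=
  ∀ r ∈ Set.Icc (σ b) (σ c), x r - x (σ b) ≤ θ * (y r - y (σ b))

/-- `P` is a strict record of the tilted height as seen from `b`, and the nodes from `P` to `c` lie
in the cone of `b` without exceeding the tilted height of `P`. -/
structure IsPool (N : ℕ) (σ : ℕ → ℝ) (x y : ℝ → ℝ) (θ : ℝ) (b P c : ℕ) : Prop where
  isRecord : IsRecord (tilt σ x y θ) b P
  le_end : P ≤ c
  end_le : c ≤ N
  inCone : InCone σ x y θ b c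
  tilt_le : ∀ j, P ≤ j → j ≤ c → tilt σ x y θ j ≤ tilt σ x y θ P

/-- The last node belonging to a pool of `P`. -/
def poolEnd (N : ℕ) (σ : ℕ → ℝ) (x y : ℝ → ℝ) (θ : ℝ) (P : ℕ) : ℕ :=
  Nat.findGreatest (fun c => ∃ b, IsPool N σ x y θ b P c) N

/-- The width of the largest pool of `P`. -/
def poolWidth (N : ℕ) (σ : ℕ → ℝ) (x y : ℝ → ℝ) (θ : ℝ) (P : ℕ) : ℝ :=
  x (σ (poolEnd N σ x y θ P)) - x (σ P)

/-- The chords of constant tilted height spanning the pools. -/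
def poolChords (N : ℕ) (σ : ℕ → ℝ) (x y : ℝ → ℝ) (θ : ℝ) : Finset (Plane × Plane) :=
  (Finset.range (N + 1)).image fun P => (pt (x (σ P)) (y (σ P)),
    pt (x (σ P) + poolWidth N σ x y θ P) (y (σ P) + 2 * poolWidth N σ x y θ P / (3 * θ)))

namespace IsTameCurve

variable {N : ℕ} {σ : ℕ → ℝ} {x y : ℝ → ℝ} {θ : ℝ}

lemma isPool_self {P : ℕ} (hP : P ≤ N) : IsPool N σ x y θ P P P where
  isRecord := ⟨le_rfl, fun j h1 h2 => by omega⟩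
  le_end := le_rfl
  end_le := hP
  inCone := fun r hr => by rw [le_antisymm hr.2 hr.1]; simp
  tilt_le := fun j h1 h2 => by rw [le_antisymm h2 h1]

lemma exists_isPool_poolEnd {P : ℕ} (hP : P ≤ N) :
    ∃ b, IsPool N σ x y θ b P (poolEnd N σ x y θ P) :=
  Nat.findGreatest_spec (P := fun c => ∃ b, IsPool N σ x y θ b P c) hP ⟨P, isPool_self hP⟩

lemma _root_.IsPool.le_poolEnd {b P c : ℕ} (h : IsPool N σ x y θ b P c) :
    c ≤ poolEnd N σ x y θ P :=
  Nat.le_findGreatest h.end_le ⟨b, h⟩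

lemma poolEnd_le (P : ℕ) : poolEnd N σ x y θ P ≤ N := Nat.findGreatest_le N

lemma le_poolWidth (h : IsTameCurve N σ x y) {b P c : ℕ} (hp : IsPool N σ x y θ b P c) :
    x (σ c) - x (σ P) ≤ poolWidth N σ x y θ P := by
  have := h.x_le (h.node_mem hp.end_le).1 (h.mono hp.le_poolEnd) (h.mono (poolEnd_le P))
  unfold poolWidth
  linarith

lemma poolWidth_nonneg (h : IsTameCurve N σ x y) {P : ℕ} (hP : P ≤ N) :
    0 ≤ poolWidth N σ x y θ P := by
  simpa using h.le_poolWidth (isPool_self (θ := θ) hP)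

/-- The total width of the pools. -/
lemma sum_poolWidth_le (h : IsTameCurve N σ x y) (hθ : 0 < θ) :
    ∑ P ∈ Finset.range (N + 1), poolWidth N σ x y θ P ≤ 3 * θ * (σ N - σ 0) := by
  have hex : ∀ P, ∃ b, P ≤ N → IsPool N σ x y θ b P (poolEnd N σ x y θ P) := by
    intro P
    by_cases hP : P ≤ N
    · obtain ⟨b, hb⟩ := exists_isPool_poolEnd (σ := σ) (x := x) (y := y) (θ := θ) hP
      exact ⟨b, fun _ => hb⟩
    · exact ⟨0, fun h => absurd h hP⟩
  choose s hs using hex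
  refine (sum_pool_width_le (F := tilt σ x y θ) (X := fun k => x (σ k)) (s := s)
    (e := poolEnd N σ x y θ)
    (fun i j hij hj => h.x_le (h.node_mem (hij.trans hj)).1 (h.mono hij) (h.mono hj))
    (fun P hP => (hs P hP).le_end) (fun P _ => poolEnd_le P) (fun P hP => (hs P hP).isRecord)
    (fun P hP => (hs P hP).tilt_le) ?_).trans ?_
  · intro P hP
    have h1 := (hs P hP).tilt_le _ (hs P hP).le_end le_rfl
    have h2 := (hs P hP).inCone (σ (poolEnd N σ x y θ P))
      ⟨h.mono ((hs P hP).isRecord.1.trans (hs P hP).le_end), le_rfl⟩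
    simp only [tilt] at h1 ⊢
    linarith
  · rw [← Finset.sum_range_sub σ N, Finset.mul_sum]
    refine Finset.sum_le_sum fun k hk => ?_
    rw [Finset.mem_range] at hk
    have hm := h.mono (Nat.le_succ k)
    have h1 := h.sub_add_abs_sub_le (h.node_mem hk.le).1 hm (h.mono hk)
    have h2 := h.x_le (h.node_mem hk.le).1 hm (h.mono hk)
    have h3 := le_abs_self (y (σ (k + 1)) - y (σ k))
    rw [Nat.succ_eq_add_one] at *
    refine max_le (mul_nonneg (by linarith) (by linarith)) ?_
    have : θ * (y (σ (k + 1)) - y (σ k)) ≤ θ * (σ (k + 1) - σ k) :=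
      mul_le_mul_of_nonneg_left (by linarith) hθ.le
    simp only [tilt]
    linarith

lemma gweight_poolChords_le (h : IsTameCurve N σ x y) (hθ : 0 < θ) (hθ1 : θ ≤ 1) :
    gweight (poolChords N σ x y θ) ≤ 6 * (σ N - σ 0) := by
  have hterm : gweight (poolChords N σ x y θ) ≤
      ∑ P ∈ Finset.range (N + 1), 2 / θ * poolWidth N σ x y θ P := by
    refine (gweight_image_le _ _).trans (Finset.sum_le_sum fun P hP => ?_)
    have hw := h.poolWidth_nonneg (θ := θ) (Nat.lt_succ_iff.1 (Finset.mem_range.1 hP))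
    refine (norm_sub_le_abs_add_abs _ _).trans ?_
    have e2 : 0 ≤ 2 * poolWidth N σ x y θ P / (3 * θ) := by positivity
    simp only [pt_zero, pt_one, sub_add_cancel_left, abs_neg, abs_of_nonneg hw, abs_of_nonneg e2]
    have e3 : 2 * poolWidth N σ x y θ P / (3 * θ) = 2 / 3 * (poolWidth N σ x y θ P / θ) := by
      field_simp
    have e4 : poolWidth N σ x y θ P ≤ poolWidth N σ x y θ P / θ := by
      rw [le_div_iff₀ hθ]; nlinarith
    have e5 : 2 / θ * poolWidth N σ x y θ P = 2 * (poolWidth N σ x y θ P / θ) := by ring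
    rw [e3, e5]
    linarith [hw.trans e4]
  refine hterm.trans ?_
  rw [← Finset.mul_sum]
  refine (mul_le_mul_of_nonneg_left (h.sum_poolWidth_le hθ) (by positivity)).trans (le_of_eq ?_)
  field_simp
  ring

lemma hasPath_poolChord (hθ : 0 < θ) {P : ℕ} (hP : P ≤ N) {Y : ℝ}
    (h1 : y (σ P) ≤ Y) (h2 : 3 / 2 * θ * (Y - y (σ P)) ≤ poolWidth N σ x y θ P) :
    HasPath (poolChords N σ x y θ) (pt (x (σ P)) (y (σ P)))
      (pt (x (σ P) + 3 / 2 * θ * (Y - y (σ P))) Y) ((1 + 2 * θ ^ 2) * (Y - y (σ P))) := by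
  rcases h1.eq_or_lt with rfl | hlt
  · simpa using HasPath.refl (poolChords N σ x y θ) _
  have hpos : 0 < Y - y (σ P) := by linarith
  have hw : 0 < poolWidth N σ x y θ P := lt_of_lt_of_le (by positivity) h2
  have hmem : (pt (x (σ P)) (y (σ P)), pt (x (σ P) + poolWidth N σ x y θ P)
      (y (σ P) + 2 * poolWidth N σ x y θ P / (3 * θ))) ∈ poolChords N σ x y θ :=
    Finset.mem_image.2 ⟨P, Finset.mem_range.2 (by omega), rfl⟩
  refine (HasPath.of_mem hmem (left_mem_segment ℝ _ _) (pt_mem_segment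
    (τ := 3 / 2 * θ * (Y - y (σ P)) / poolWidth N σ x y θ P) (by positivity)
    ((div_le_one hw).2 h2) ?_ ?_)).mono_weight ?_
  · field_simp
    ring
  · field_simp
    ring
  · have e : (1 + 2 * θ ^ 2) * (Y - y (σ P)) = (Y - y (σ P)) + 2 * θ ^ 2 * (Y - y (σ P)) := by ring
    rw [e, norm_sub_rev]
    refine norm_sub_le_height_add (d := 3 / 2 * θ * (Y - y (σ P))) hpos ?_ ?_ ?_
    · simp [abs_of_pos hpos]
    · simp only [pt_zero, add_sub_cancel_left]
      rw [abs_of_pos (by positivity)]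
    · nlinarith [sq_nonneg (θ * (Y - y (σ P)))]

/-- From `b` one can climb almost vertically to every level below a record `k`. -/
lemma hasPath_highway (h : IsTameCurve N σ x y) (hθ : 0 < θ) {b : ℕ} : ∀ k ≤ N,
    IsRecord (tilt σ x y θ) b k → InCone σ x y θ b k → ∀ Y, y (σ b) ≤ Y → Y ≤ y (σ k) →
    ∃ X ≤ x (σ k), 3 * θ * Y - 2 * X ≤ tilt σ x y θ k ∧
      HasPath (curveEdges N σ x y ∪ poolChords N σ x y θ) (pt (x (σ b)) (y (σ b))) (pt X Y)
        ((1 + 2 * θ ^ 2) * (Y - y (σ b))) := by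
  intro k
  induction k using Nat.strong_induction_on with
  | _ k ih =>
  intro hkN hrec hcone Y hY1 hY2
  rcases hrec.1.eq_or_lt with rfl | hbk
  · have : Y = y (σ b) := le_antisymm hY2 hY1
    subst this
    exact ⟨x (σ b), le_rfl, le_rfl, by simpa using HasPath.refl _ _⟩
  obtain ⟨P, hPk, hPmax, hPrec⟩ :=
    exists_isRecord_forall_le (tilt σ x y θ) (show b ≤ k - 1 by omega)
  have hbP := hPrec.1
  have hcone' : ∀ c ≤ k, InCone σ x y θ b c := fun c hc r hr =>
    hcone r ⟨hr.1, hr.2.trans (h.mono hc)⟩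
  have hpool : IsPool N σ x y θ b P (k - 1) :=
    ⟨hPrec, hPk, by omega, hcone' _ (by omega), fun j hj1 hj2 => hPmax j (by omega) hj2⟩
  have hw := h.le_poolWidth hpool
  have hbσ := (h.node_mem (show b ≤ N by omega)).1
  have hPσ := (h.node_mem (show P ≤ N by omega)).1
  have hkσ := (h.node_mem (show k - 1 ≤ N by omega)).1
  have hyP : y (σ b) ≤ y (σ P) := by
    have h1 := hcone (σ P) ⟨h.mono hbP, h.mono (by omega)⟩
    have h2 := h.x_le hbσ (h.mono hbP) (h.mono (show P ≤ N by omega))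
    exact sub_nonneg.1 (nonneg_of_mul_nonneg_right (by linarith) hθ)
  have hlt : tilt σ x y θ P < tilt σ x y θ k := hrec.2 P hbP (by omega)
  have hle : tilt σ x y θ (k - 1) ≤ tilt σ x y θ P := hPmax _ (by omega) le_rfl
  have hxP := h.x_le hPσ (h.mono hPk) (h.mono (show k - 1 ≤ N by omega))
  have hstep : σ (k - 1) ≤ σ k := h.mono (by omega)
  have hup : ∀ t ∈ Set.Icc (σ (k - 1)) (σ k), x t = x (σ (k - 1)) ∧
      y t = y (σ (k - 1)) + (t - σ (k - 1)) := by
    have hedge := h.edge (k - 1) (by omega)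
    rw [show k - 1 + 1 = k by omega] at hedge
    have hk' : σ k ∈ Set.Icc (σ (k - 1)) (σ k) := ⟨hstep, le_rfl⟩
    have hlt' := hle.trans_lt hlt
    simp only [tilt] at hlt'
    rcases hedge with e | e | e
    · exfalso
      rw [(e _ hk').1, (e _ hk').2] at hlt'
      linarith
    · exact e
    · exfalso
      rw [(e _ hk').1, (e _ hk').2] at hlt'
      have : 0 ≤ θ * (σ k - σ (k - 1)) := mul_nonneg hθ.le (by linarith)
      nlinarith
  have hxk : x (σ k) = x (σ (k - 1)) := (hup _ ⟨hstep, le_rfl⟩).1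
  have hyk : y (σ k) = y (σ (k - 1)) + (σ k - σ (k - 1)) := (hup _ ⟨hstep, le_rfl⟩).2
  rcases le_total Y (y (σ P)) with hYP | hYP
  · obtain ⟨X, hX1, hX2, hX3⟩ := ih P (by omega) (by omega) hPrec (hcone' P (by omega)) Y hY1 hYP
    exact ⟨X, by linarith, hX2.trans hlt.le, hX3⟩
  have hbase : HasPath (curveEdges N σ x y ∪ poolChords N σ x y θ) (pt (x (σ b)) (y (σ b)))
      (pt (x (σ P)) (y (σ P))) ((1 + 2 * θ ^ 2) * (y (σ P) - y (σ b))) := by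
    obtain ⟨X, hX1, hX2, hX3⟩ := ih P (by omega) (by omega) hPrec (hcone' P (by omega))
      (y (σ P)) hyP le_rfl
    have : X = x (σ P) := by
      simp only [tilt] at hX2
      linarith
    rwa [this] at hX3
  rcases le_total (3 / 2 * θ * (Y - y (σ P))) (x (σ k) - x (σ P)) with hYz | hYz
  · refine ⟨x (σ P) + 3 / 2 * θ * (Y - y (σ P)), by linarith, ?_, ?_⟩
    · simp only [tilt] at hlt ⊢
      linarith
    · refine (hbase.trans ((hasPath_poolChord hθ (show P ≤ N by omega) hYP
        (by linarith)).mono Finset.subset_union_right)).mono_weight (le_of_eq ?_)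
      ring
  · obtain ⟨Z, hZ⟩ : ∃ Z, 3 / 2 * θ * (Z - y (σ P)) = x (σ k) - x (σ P) :=
      ⟨y (σ P) + (x (σ k) - x (σ P)) / (3 / 2 * θ), by field_simp; ring⟩
    have hZP : y (σ P) ≤ Z := by
      refine sub_nonneg.1 (nonneg_of_mul_nonneg_right (a := 3 / 2 * θ) ?_ (by positivity))
      linarith
    have hZY : Z ≤ Y := by
      have : 3 / 2 * θ * (Z - y (σ P)) ≤ 3 / 2 * θ * (Y - y (σ P)) := by linarith
      linarith [le_of_mul_le_mul_left this (by positivity)]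
    have hZk : y (σ (k - 1)) ≤ Z := by
      simp only [tilt] at hle
      have : 3 * θ * y (σ (k - 1)) ≤ 3 * θ * Z := by linarith
      exact le_of_mul_le_mul_left this (by positivity)
    refine ⟨x (σ k), le_rfl, ?_, ?_⟩
    · simp only [tilt]
      have : 3 * θ * Y ≤ 3 * θ * y (σ k) := mul_le_mul_of_nonneg_left hY2 (by positivity)
      linarith
    · have p1 := hasPath_poolChord (σ := σ) (x := x) (y := y) hθ (show P ≤ N by omega) hZP (by linarith)
      rw [hZ, add_sub_cancel] at p1
      have p2 := h.hasPath_arc (s := σ (k - 1) + (Z - y (σ (k - 1))))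
        (t := σ (k - 1) + (Y - y (σ (k - 1)))) (by linarith) (by linarith)
        (by linarith [h.mono hkN])
      have m1 := hup (σ (k - 1) + (Z - y (σ (k - 1)))) ⟨by linarith, by linarith⟩
      have m2 := hup (σ (k - 1) + (Y - y (σ (k - 1)))) ⟨by linarith, by linarith⟩
      rw [m1.1, m1.2, m2.1, m2.2, ← hxk] at p2
      simp only [add_sub_cancel_left, add_sub_cancel] at p2
      refine ((hbase.trans (p1.mono Finset.subset_union_right)).trans
        (p2.mono Finset.subset_union_left)).mono_weight ?_
      nlinarith [mul_nonneg (sq_nonneg θ) (sub_nonneg.2 hZY)]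

/-- The highway of a record `P`, extended by its chord. -/
lemma hasPath_highway_chord (h : IsTameCurve N σ x y) (hθ : 0 < θ) {b P c : ℕ}
    (hp : IsPool N σ x y θ b P c) {Y : ℝ} (hY : y (σ b) ≤ Y)
    (hY2 : 3 / 2 * θ * (Y - y (σ P)) ≤ x (σ c) - x (σ P)) :
    ∃ X ≤ x (σ c), 3 * θ * Y - 2 * X ≤ tilt σ x y θ P ∧
      HasPath (curveEdges N σ x y ∪ poolChords N σ x y θ) (pt (x (σ b)) (y (σ b))) (pt X Y)
        ((1 + 2 * θ ^ 2) * (Y - y (σ b))) := by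
  have hPN : P ≤ N := hp.le_end.trans hp.end_le
  have hbP := hp.isRecord.1
  have hcone : InCone σ x y θ b P := fun r hr =>
    hp.inCone r ⟨hr.1, hr.2.trans (h.mono hp.le_end)⟩
  have hxc := h.x_le (h.node_mem hPN).1 (h.mono hp.le_end) (h.mono hp.end_le)
  rcases le_total Y (y (σ P)) with hYP | hYP
  · obtain ⟨X, h1, h2, h3⟩ := h.hasPath_highway hθ P hPN hp.isRecord hcone Y hY hYP
    exact ⟨X, h1.trans hxc, h2, h3⟩
  · have hyP : y (σ b) ≤ y (σ P) := by
      have h1 := hcone (σ P) ⟨h.mono hbP, le_rfl⟩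
      have h2 := h.x_le (h.node_mem (hbP.trans hPN)).1 (h.mono hbP) (h.mono hPN)
      exact sub_nonneg.1 (nonneg_of_mul_nonneg_right (by linarith) hθ)
    obtain ⟨X, hX1, hX2, hX3⟩ := h.hasPath_highway hθ P hPN hp.isRecord hcone _ hyP le_rfl
    have hX : X = x (σ P) := by
      simp only [tilt] at hX2
      linarith
    rw [hX] at hX3
    refine ⟨x (σ P) + 3 / 2 * θ * (Y - y (σ P)), by linarith, ?_, ?_⟩
    · simp only [tilt]
      linarith
    · refine (hX3.trans ((hasPath_poolChord hθ hPN hYP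
        (hY2.trans (h.le_poolWidth hp))).mono Finset.subset_union_right)).mono_weight (le_of_eq ?_)
      ring

end IsTameCurve

namespace IsTameCurve

variable {N : ℕ} {σ : ℕ → ℝ} {x y : ℝ → ℝ} {θ : ℝ}

set_option maxHeartbeats 1000000 in
/-- A gadget of width `e` at the parameter `s`, joining horizontal levels to the nearby points of
the curve to the right of `s` almost without detour. -/
lemma exists_box (h : IsTameCurve N σ x y) (hθ0 : 0 < θ) (hθ1 : θ ≤ 1) {s e V : ℝ}
    (hs : σ 0 ≤ s) (he : 0 < e) (hV : e = θ * V) :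
    ∃ B : Finset (Plane × Plane), gweight B ≤ 40000 * (V / θ) ∧
      ∀ a, s ≤ a → a ≤ σ N → a ≤ s + 13 * V → x a ≤ x s + e → y s - 2 * V ≤ y a →
        y a ≤ y s + V → ∃ Y, y a - V / 2 ≤ Y ∧ Y ≤ y a - 3 / 8 * V ∧
          ∀ X, x s - 4 * e ≤ X → X ≤ x s + e →
            HasPath (B ∪ curveEdges N σ x y) (pt X Y) (pt (x a) (y a))
              (y a - Y + 69 * (θ ^ 2 * V)) := by
  have hVpos : 0 < V := pos_of_mul_pos_right (hV ▸ he) hθ0.le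
  obtain ⟨K, hK1, hK2⟩ : ∃ K : ℕ, 16 / θ ≤ K ∧ (K : ℝ) ≤ 17 / θ := by
    refine ⟨⌈16 / θ⌉₊, Nat.le_ceil _, (Nat.ceil_lt_add_one (by positivity)).le.trans ?_⟩
    rw [div_add_one hθ0.ne']
    gcongr
    linarith
  have hKpos : (0 : ℝ) < K := lt_of_lt_of_le (by positivity) hK1
  rw [div_le_iff₀ hθ0] at hK1
  obtain ⟨μ, hKμ⟩ : ∃ μ : ℝ, K * μ = e := ⟨e / K, by field_simp⟩
  have hμ : 0 < μ := by
    have : 0 < K * μ := by rw [hKμ]; exact he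
    exact pos_of_mul_pos_right this hKpos.le
  have hμ16 : 16 * μ ≤ θ ^ 2 * V := by
    have : 16 * μ ≤ K * θ * μ := mul_le_mul_of_nonneg_right hK1 hμ.le
    nlinarith
  have hθ2 : θ ^ 2 * V ≤ V := by
    have : θ ^ 2 ≤ 1 := by nlinarith
    nlinarith
  have heV : e ≤ V := by nlinarith
  obtain ⟨J, hJ1, hJ2⟩ : ∃ J : ℕ, 13 * V ≤ J * μ ∧ J * μ ≤ 13 * V + μ := by
    refine ⟨⌈13 * V / μ⌉₊, ?_, ?_⟩
    · have := Nat.le_ceil (13 * V / μ)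
      rwa [div_le_iff₀ hμ] at this
    · have := (Nat.ceil_lt_add_one (by positivity : 0 ≤ 13 * V / μ)).le
      rw [div_add_one hμ.ne', le_div_iff₀ hμ] at this
      exact this
  obtain ⟨L, hL⟩ : ∃ L : ℕ → ℝ, ∀ m : ℕ, L m = y s - 3 * V + m * (V / 8) := ⟨_, fun _ => rfl⟩
  obtain ⟨g, hg⟩ : ∃ g : ℕ → ℝ, ∀ k : ℕ, g k = x s - 4 * e + k * μ := ⟨_, fun _ => rfl⟩
  obtain ⟨A, hA⟩ : ∃ A : Finset (Plane × Plane), A = (Finset.range 41).image fun m =>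
    (pt (x s - 4 * e) (L m), pt (x s + e) (L m)) := ⟨_, rfl⟩
  obtain ⟨U, hU⟩ : ∃ U : Finset (Plane × Plane), U =
    ((Finset.range (5 * K + 1)) ×ˢ (Finset.range 41)).image fun q =>
      (pt (g q.1) (L q.2), pt (x s) (L q.2 + V / 8)) := ⟨_, rfl⟩
  obtain ⟨D, hD⟩ : ∃ D : Finset (Plane × Plane), D =
    ((Finset.range (5 * K + 1)) ×ˢ (Finset.range 41)).image fun q =>
      (pt (g q.1) (L q.2), pt (x s) (L q.2 - V / 8)) := ⟨_, rfl⟩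
  obtain ⟨G, hG⟩ : ∃ G, G = comb x y s (σ N) μ K J (y s - 3 * V) (y s + 2 * V) := ⟨_, rfl⟩
  have hgrange : ∀ k ≤ 5 * K, x s - 4 * e ≤ g k ∧ g k ≤ x s + e := by
    intro k hk
    have h1 : (k : ℝ) * μ ≤ (5 * K : ℕ) * μ :=
      mul_le_mul_of_nonneg_right (by exact_mod_cast hk) hμ.le
    have h2 : (0 : ℝ) ≤ k * μ := by positivity
    push_cast at h1
    rw [hg]
    constructor <;> linarith
  refine ⟨A ∪ U ∪ D ∪ G, ?_, ?_⟩
  · have hVθ : V ≤ V / θ := by rw [le_div_iff₀ hθ0]; nlinarith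
    have hKV : (K : ℝ) * V ≤ 17 * (V / θ) := by
      calc (K : ℝ) * V ≤ 17 / θ * V := by gcongr
        _ = 17 * (V / θ) := by ring
    have w1 : gweight A ≤ 41 * (5 * e) := by
      rw [hA]
      refine (gweight_image_le_card_mul _ _ (ℓ := 5 * e) fun m _ => ?_).trans (by simp)
      rw [norm_sub_rev, norm_sub_of_snd_eq (by simp)]
      simp only [pt_zero]
      rw [abs_of_nonneg (by linarith)]
      linarith
    have hedge : ∀ k ≤ 5 * K, ∀ Y δ : ℝ, |δ| = V / 8 →
        ‖pt (g k) Y - pt (x s) (Y + δ)‖ ≤ 5 * V := by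
      intro k hk Y δ hδ
      refine (norm_sub_le_abs_add_abs _ _).trans ?_
      simp only [pt_zero, pt_one, sub_add_cancel_left, abs_neg, hδ]
      have : |g k - x s| ≤ 4 * e := by
        rw [abs_le]
        constructor <;> linarith [(hgrange k hk).1, (hgrange k hk).2]
      linarith
    have hcard : (((Finset.range (5 * K + 1)) ×ˢ (Finset.range 41)).card : ℝ) * (5 * V) ≤
        17630 * (V / θ) := by
      rw [Finset.card_product, Finset.card_range, Finset.card_range]
      push_cast
      linarith
    have w2 : gweight U ≤ 17630 * (V / θ) := by
      rw [hU]
      refine (gweight_image_le_card_mul _ _ (ℓ := 5 * V) fun q hq => ?_).trans hcard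
      have := Finset.mem_range.1 (Finset.mem_product.1 hq).1
      exact hedge q.1 (by omega) _ _ (abs_of_pos (by positivity))
    have w3 : gweight D ≤ 17630 * (V / θ) := by
      rw [hD]
      refine (gweight_image_le_card_mul _ _ (ℓ := 5 * V) fun q hq => ?_).trans hcard
      have := Finset.mem_range.1 (Finset.mem_product.1 hq).1
      have h2 := hedge q.1 (by omega) (L q.2) (-(V / 8)) (by rw [abs_neg, abs_of_pos (by positivity)])
      rwa [← sub_eq_add_neg] at h2
    have w4 := h.gweight_comb_le hs hμ K J (by linarith : y s - 3 * V ≤ y s + 2 * V)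
    rw [← hG] at w4
    have w5 := gweight_union_le (A ∪ U ∪ D) G
    have w6 := gweight_union_le (A ∪ U) D
    have w7 := gweight_union_le A U
    have w8 : ((K : ℝ) + 1) * (y s + 2 * V - (y s - 3 * V)) = 5 * (K * V) + 5 * V := by ring
    rw [w8] at w4
    linarith
  · intro a hsa haN haV hxa hya1 hya2
    obtain ⟨m, hm1, hm2⟩ : ∃ m : ℕ, y a - V / 2 ≤ L m ∧ L m ≤ y a - 3 / 8 * V := by
      have hnn : 0 ≤ (y a - V / 2 - (y s - 3 * V)) / (V / 8) :=
        div_nonneg (by linarith) (by linarith)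
      refine ⟨⌈(y a - V / 2 - (y s - 3 * V)) / (V / 8)⌉₊, ?_, ?_⟩
      · have := Nat.le_ceil ((y a - V / 2 - (y s - 3 * V)) / (V / 8))
        rw [div_le_iff₀ (by positivity)] at this
        rw [hL]
        linarith
      · have := (Nat.ceil_lt_add_one hnn).le
        rw [div_add_one (by positivity), le_div_iff₀ (by positivity)] at this
        rw [hL]
        linarith
    have hm : m ≤ 38 := by
      rw [hL] at hm2
      have : (m : ℝ) * (V / 8) ≤ 38 * (V / 8) := by linarith
      exact_mod_cast le_of_mul_le_mul_right this (by positivity)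
    have hL1 : L (m + 1) = L m + V / 8 := by rw [hL, hL]; push_cast; ring
    have hL2 : L (m + 2) = L m + V / 8 + V / 8 := by rw [hL, hL]; push_cast; ring
    have hLm : y s - 3 * V ≤ L m := by
      rw [hL]
      have : (0 : ℝ) ≤ m * (V / 8) := by positivity
      linarith
    refine ⟨L m, hm1, hm2, fun X hX1 hX2 => ?_⟩
    obtain ⟨k, hkK, hkx, hk⟩ := h.hasPath_comb hs hμ (K := K) (J := J) (a := a)
      (Ylo := y s - 3 * V) (Yhi := y s + 2 * V) (Y := L (m + 2)) hsa haN
      (by linarith) (by linarith) (by linarith) (by linarith) (by linarith) (by linarith)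
    rw [← hG, abs_of_nonneg (by linarith)] at hk
    set j := ⌊(X - (x s - 4 * e)) / μ⌋₊ with hj
    have hj1 := floor_mul_le_and_sub_le hμ (sub_nonneg.2 hX1)
    rw [← hj] at hj1
    have hj5 : j ≤ 5 * K := by
      have : (j : ℝ) * μ ≤ (5 * K : ℕ) * μ := by push_cast; linarith
      exact_mod_cast le_of_mul_le_mul_right this hμ
    have hgj : g j ≤ X ∧ X - g j ≤ μ := by
      rw [hg]
      constructor <;> linarith [hj1.1, hj1.2]
    have p1 : HasPath A (pt X (L m)) (pt (g j) (L m)) |X - g j| := by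
      refine HasPath.horizontal (x₁ := x s - 4 * e) (x₂ := x s + e) ?_ hX1 hX2
        (hgrange j hj5).1 (hgrange j hj5).2
      rw [hA]
      exact Finset.mem_image.2 ⟨m, Finset.mem_range.2 (by omega), rfl⟩
    have p2 : HasPath U (pt (g j) (L m)) (pt (x s) (L (m + 1))) (V / 8 + 64 * (θ ^ 2 * V)) := by
      have hmem : (pt (g j) (L m), pt (x s) (L (m + 1))) ∈ U := by
        rw [hU, hL1]
        exact Finset.mem_image.2 ⟨(j, m), Finset.mem_product.2 ⟨Finset.mem_range.2 (by omega),
          Finset.mem_range.2 (by omega)⟩, rfl⟩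
      refine (HasPath.of_edge hmem).mono_weight ?_
      refine norm_sub_le_height_add (d := 4 * e) (by positivity) ?_ ?_ ?_
      · simp only [pt_one, hL1, sub_add_cancel_left, abs_neg]
        exact abs_of_pos (by positivity)
      · simp only [pt_zero]
        rw [abs_le]
        constructor <;> linarith [(hgrange j hj5).1, (hgrange j hj5).2]
      · rw [hV]
        nlinarith
    have hgk : g (4 * K + k) = x s + k * μ := by
      rw [hg]
      push_cast
      linarith
    have p3 : HasPath D (pt (x s) (L (m + 1))) (pt (x s + k * μ) (L (m + 2)))
        (V / 8 + 4 * (θ ^ 2 * V)) := by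
      have hmem : (pt (x s + k * μ) (L (m + 2)), pt (x s) (L (m + 1))) ∈ D := by
        rw [hD, ← hgk]
        refine Finset.mem_image.2 ⟨(4 * K + k, m + 2), Finset.mem_product.2
          ⟨Finset.mem_range.2 (by omega), Finset.mem_range.2 (by omega)⟩, ?_⟩
        simp only [Prod.mk.injEq, true_and]
        rw [hL1, hL2]
        congr 1
        ring
      refine (HasPath.of_edge hmem).symm.mono_weight ?_
      refine norm_sub_le_height_add (d := e) (by positivity) ?_ ?_ ?_
      · simp only [pt_one, hL1, hL2, add_sub_cancel_left]
        exact abs_of_pos (by positivity)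
      · simp only [pt_zero, add_sub_cancel_left]
        rw [abs_of_nonneg (by positivity), ← hKμ]
        exact mul_le_mul_of_nonneg_right (by exact_mod_cast hkK) hμ.le
      · rw [hV]
        nlinarith
    have q1 := p1.mono (F := A ∪ U ∪ D ∪ G ∪ curveEdges N σ x y)
      (fun e he => by simp only [Finset.mem_union]; tauto)
    have q2 := p2.mono (F := A ∪ U ∪ D ∪ G ∪ curveEdges N σ x y)
      (fun e he => by simp only [Finset.mem_union]; tauto)
    have q3 := p3.mono (F := A ∪ U ∪ D ∪ G ∪ curveEdges N σ x y)
      (fun e he => by simp only [Finset.mem_union]; tauto)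
    have q4 := hk.mono (F := A ∪ U ∪ D ∪ G ∪ curveEdges N σ x y)
      (fun e he => by simp only [Finset.mem_union] at he ⊢; tauto)
    refine (((q1.trans q2).trans q3).trans q4).mono_weight ?_
    rw [abs_of_nonneg (by linarith [hgj.1]), hL2]
    linarith [hgj.2]

end IsTameCurve

namespace IsTameCurve

variable {N : ℕ} {σ : ℕ → ℝ} {x y : ℝ → ℝ} {θ : ℝ}

/-- A graph joining all pairs of nodes for which the curve stays in the steep cone of the first. -/
lemma exists_cone_spanner (h : IsTameCurve N σ x y) (hθ0 : 0 < θ) (hθ1 : θ ≤ 1) :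
    ∃ E, gweight E ≤ 240007 * ((σ N - σ 0) / θ) ∧
      ∀ b a, b ≤ a → a ≤ N → InCone σ x y θ b a →
        HasPath E (pt (x (σ b)) (y (σ b))) (pt (x (σ a)) (y (σ a)))
          ((1 + 200 * θ ^ 2) * (y (σ a) - y (σ b))) := by
  have hw0 : ∀ P ≤ N, 0 ≤ poolWidth N σ x y θ P := fun P hP => h.poolWidth_nonneg hP
  have hbox : ∀ P i : ℕ, ∃ B : Finset (Plane × Plane), P ≤ N →
      gweight B ≤ 40000 * (poolWidth N σ x y θ P / θ ^ 2 * (1 / 2) ^ i) ∧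
      ∀ V, poolWidth N σ x y θ P * (1 / 2) ^ i = θ * V → 0 < V →
      ∀ a, σ P ≤ a → a ≤ σ N → a ≤ σ P + 13 * V → x a ≤ x (σ P) + θ * V →
        y (σ P) - 2 * V ≤ y a →
        y a ≤ y (σ P) + V → ∃ Y, y a - V / 2 ≤ Y ∧ Y ≤ y a - 3 / 8 * V ∧
          ∀ X, x (σ P) - 4 * (θ * V) ≤ X → X ≤ x (σ P) + θ * V →
            HasPath (B ∪ curveEdges N σ x y) (pt X Y) (pt (x a) (y a))
              (y a - Y + 69 * (θ ^ 2 * V)) := by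
    intro P i
    by_cases hP : P ≤ N
    · rcases (hw0 P hP).eq_or_lt with hw | hw
      · refine ⟨∅, fun _ => ⟨by simp [gweight, ← hw], fun V hV hpos => ?_⟩⟩
        rw [← hw, zero_mul] at hV
        exact absurd hV (mul_pos hθ0 hpos).ne
      · obtain ⟨B, hB1, hB2⟩ := h.exists_box hθ0 hθ1 (s := σ P)
          (e := poolWidth N σ x y θ P * (1 / 2) ^ i)
          (V := poolWidth N σ x y θ P * (1 / 2) ^ i / θ) (h.node_mem hP).1 (by positivity)
          (by field_simp)
        refine ⟨B, fun _ => ⟨hB1.trans (le_of_eq (by field_simp)), fun V hV hpos => ?_⟩⟩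
        rw [hV, mul_div_cancel_left₀ _ hθ0.ne'] at hB2
        exact hB2
    · exact ⟨∅, fun h => absurd h hP⟩
  choose B hB using hbox
  obtain ⟨M, hM⟩ : ∃ M : ℕ, ∀ P ∈ Finset.range (N + 1), ∀ c ∈ Finset.range (N + 1),
      0 < x (σ c) - x (σ P) → poolWidth N σ x y θ P / (x (σ c) - x (σ P)) < 2 ^ M := by
    refine Filter.Eventually.exists (f := Filter.atTop) ?_
    simp only [Filter.eventually_all_finset]
    intro P _ c _
    filter_upwards [(tendsto_pow_atTop_atTop_of_one_lt (one_lt_two (α := ℝ))).eventually_gt_atTop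
      (poolWidth N σ x y θ P / (x (σ c) - x (σ P)))] with M hM _
    exact hM
  have hL : 0 ≤ σ N - σ 0 := sub_nonneg.2 (h.mono (Nat.zero_le N))
  refine ⟨(curveEdges N σ x y ∪ poolChords N σ x y θ) ∪
    (Finset.range (N + 1)).biUnion fun P => (Finset.range M).biUnion (B P), ?_, ?_⟩
  · have h1 := h.gweight_curveEdges_le
    have h2 := h.gweight_poolChords_le hθ0 hθ1
    have h3 : gweight ((Finset.range (N + 1)).biUnion fun P => (Finset.range M).biUnion (B P)) ≤
        240000 * ((σ N - σ 0) / θ) := by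
      refine (gweight_biUnion_le _ _).trans ?_
      have hP : ∀ P ∈ Finset.range (N + 1), gweight ((Finset.range M).biUnion (B P)) ≤
          80000 / θ ^ 2 * poolWidth N σ x y θ P := by
        intro P hP
        have hPN : P ≤ N := Nat.lt_succ_iff.1 (Finset.mem_range.1 hP)
        refine (gweight_biUnion_le _ _).trans
          ((Finset.sum_le_sum fun i _ => (hB P i hPN).1).trans ?_)
        rw [← Finset.mul_sum, ← Finset.mul_sum]
        have hg : ∑ i ∈ Finset.range M, ((1 : ℝ) / 2) ^ i ≤ 2 := by
          rw [geom_sum_eq (by norm_num), div_le_iff_of_neg (by norm_num)]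
          have : (0 : ℝ) ≤ (1 / 2) ^ M := by positivity
          linarith
        have hq : 0 ≤ poolWidth N σ x y θ P / θ ^ 2 := div_nonneg (hw0 P hPN) (sq_nonneg θ)
        calc _ ≤ 40000 * (poolWidth N σ x y θ P / θ ^ 2 * 2) := by gcongr
          _ = _ := by ring
      refine (Finset.sum_le_sum hP).trans ?_
      rw [← Finset.mul_sum]
      calc _ ≤ 80000 / θ ^ 2 * (3 * θ * (σ N - σ 0)) := by
            gcongr
            exact h.sum_poolWidth_le hθ0
        _ = _ := by field_simp; ring
    have h4 : σ N - σ 0 ≤ (σ N - σ 0) / θ := by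
      rw [le_div_iff₀ hθ0]; nlinarith
    have h5 := gweight_union_le (curveEdges N σ x y ∪ poolChords N σ x y θ)
      ((Finset.range (N + 1)).biUnion fun P => (Finset.range M).biUnion (B P))
    have h6 := gweight_union_le (curveEdges N σ x y) (poolChords N σ x y θ)
    linarith
  intro b a hba haN hcone
  obtain ⟨P, hPa, hPmax, hPrec⟩ := exists_isRecord_forall_le (tilt σ x y θ) hba
  have hbP := hPrec.1
  have hPN : P ≤ N := hPa.trans haN
  have hpool : IsPool N σ x y θ b P a :=
    ⟨hPrec, hPa, haN, hcone, fun j hj1 hj2 => hPmax j (hbP.trans hj1) hj2⟩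
  have hb0 := (h.node_mem (hba.trans haN)).1
  have hyb : ∀ r ∈ Set.Icc (σ b) (σ a), y (σ b) ≤ y r := by
    intro r hr
    have h1 := hcone r hr
    have h2 := h.x_le hb0 hr.1 (hr.2.trans (h.mono haN))
    exact sub_nonneg.1 (nonneg_of_mul_nonneg_right (by linarith) hθ0)
  obtain ⟨hp1, hp2⟩ := h.pool_bounds hθ1 hb0 (h.mono hbP) (h.mono hPa) (h.mono haN)
    (θ := θ) (fun r hr => by
      have := h.linear_le_of_nodes (3 * θ) (-2) (tilt σ x y θ P) hba haN
        (fun k hk1 hk2 => by have := hPmax k hk1 hk2; simp only [tilt] at this ⊢; linarith)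
        hr.1 hr.2
      simp only [tilt] at this
      linarith) hyb
  have hxPa := h.x_le (h.node_mem hPN).1 (h.mono hPa) (h.mono haN)
  have hxbP := h.x_le hb0 (h.mono hbP) (h.mono hPN)
  have htilt := hPmax a hba le_rfl
  simp only [tilt] at htilt
  have hybb := hyb (σ a) ⟨h.mono hba, le_rfl⟩
  rcases hxPa.eq_or_lt with hx0 | hx0
  · obtain ⟨X, hX1, hX2, hX3⟩ := h.hasPath_highway_chord hθ0 hpool (Y := y (σ a)) hybb (by
      nlinarith)
    simp only [tilt] at hX2
    have hya : y (σ a) = y (σ P) := by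
      have : 3 * θ * y (σ a) ≤ 3 * θ * y (σ P) := by linarith
      have := le_of_mul_le_mul_left this (by positivity)
      linarith
    have hX : X = x (σ a) := by
      rw [hya] at hX2
      linarith
    rw [hX] at hX3
    refine (hX3.mono Finset.subset_union_left).mono_weight ?_
    exact mul_le_mul_of_nonneg_right (by nlinarith [sq_nonneg θ]) (by linarith)
  have he : 0 < x (σ a) - x (σ P) := by linarith
  obtain ⟨i, hi1, hi2⟩ := exists_nat_pow_near
    (show 1 ≤ poolWidth N σ x y θ P / (x (σ a) - x (σ P)) by
      rw [le_div_iff₀ he, one_mul]; exact h.le_poolWidth hpool) (one_lt_two (α := ℝ))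
  have hiM : i < M := by
    have := hi1.trans_lt (hM P (Finset.mem_range.2 (by omega)) a (Finset.mem_range.2 (by omega)) he)
    exact (pow_lt_pow_iff_right₀ one_lt_two).1 this
  rw [le_div_iff₀ he] at hi1
  rw [div_lt_iff₀ he, pow_succ] at hi2
  have hpow : (2 : ℝ) ^ i * (1 / 2) ^ i = 1 := by rw [← mul_pow]; norm_num
  have hhalf : (0 : ℝ) < (1 / 2) ^ i := by positivity
  obtain ⟨V, hV⟩ : ∃ V, poolWidth N σ x y θ P * (1 / 2) ^ i = θ * V :=
    ⟨poolWidth N σ x y θ P * (1 / 2) ^ i / θ, by field_simp⟩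
  have hE1 : x (σ a) - x (σ P) ≤ θ * V := by
    rw [← hV]
    have := mul_le_mul_of_nonneg_right hi1 hhalf.le
    linear_combination this - (x (σ a) - x (σ P)) * hpow
  have hE2 : θ * V < 2 * (x (σ a) - x (σ P)) := by
    rw [← hV]
    have := mul_lt_mul_of_pos_right hi2 hhalf
    linear_combination this + 2 * (x (σ a) - x (σ P)) * hpow
  have hVpos : 0 < V := pos_of_mul_pos_right (he.trans_le hE1) hθ0.le
  have hθV : θ * V ≤ V := by nlinarith
  have hyaP : y (σ a) - y (σ P) ≤ 2 / 3 * V := by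
    have : θ * (y (σ a) - y (σ P)) ≤ θ * (2 / 3 * V) := by linarith
    exact le_of_mul_le_mul_left this hθ0
  have hVdy : V ≤ 2 * (y (σ a) - y (σ b)) := by
    have h1 := hcone (σ a) ⟨h.mono hba, le_rfl⟩
    have : θ * V ≤ θ * (2 * (y (σ a) - y (σ b))) := by linarith
    exact le_of_mul_le_mul_left this hθ0
  obtain ⟨Y, hY1, hY2, hY3⟩ := (hB P i hPN).2 V hV hVpos (σ a) (h.mono hPa) (h.mono haN)
    (by linarith) (by linarith) (by linarith) (by linarith)
  obtain ⟨X, hX1, hX2, hX3⟩ := h.hasPath_highway_chord hθ0 hpool (Y := Y) (by linarith) (by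
    have : θ * (Y - y (σ P)) ≤ θ * (y (σ a) - y (σ P)) :=
      mul_le_mul_of_nonneg_left (by linarith) hθ0.le
    linarith)
  simp only [tilt] at hX2
  have hX4 : x (σ P) - 4 * (θ * V) ≤ X := by
    have : θ * (y (σ P) - Y) ≤ θ * (5 / 2 * V) :=
      mul_le_mul_of_nonneg_left (by linarith) hθ0.le
    nlinarith
  have hsub : B P i ∪ curveEdges N σ x y ⊆ (curveEdges N σ x y ∪ poolChords N σ x y θ) ∪
      (Finset.range (N + 1)).biUnion fun P => (Finset.range M).biUnion (B P) := by
    refine Finset.union_subset (fun z hz => Finset.mem_union_right _ ?_)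
      (Finset.subset_union_left.trans Finset.subset_union_left)
    exact Finset.mem_biUnion.2 ⟨P, Finset.mem_range.2 (by omega),
      Finset.mem_biUnion.2 ⟨i, Finset.mem_range.2 hiM, hz⟩⟩
  refine ((hX3.mono Finset.subset_union_left).trans
    ((hY3 X hX4 (by linarith)).mono hsub)).mono_weight ?_
  have h1 : θ ^ 2 * (Y - y (σ b)) ≤ θ ^ 2 * (y (σ a) - y (σ b)) :=
    mul_le_mul_of_nonneg_left (by linarith) (sq_nonneg θ)
  have h2 : θ ^ 2 * V ≤ θ ^ 2 * (2 * (y (σ a) - y (σ b))) :=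
    mul_le_mul_of_nonneg_left hVdy (sq_nonneg θ)
  linarith [mul_nonneg (sq_nonneg θ) (sub_nonneg.2 hybb)]

end IsTameCurve

/-- The reflection of the plane in the vertical axis. -/
def reflectX : Plane →ₗ[ℝ] Plane where
  toFun p := pt (-(p 0)) (p 1)
  map_add' p q := plane_ext (by simp [add_comm]) (by simp)
  map_smul' c p := plane_ext (by simp) (by simp)

lemma reflectX_pt (a b : ℝ) : reflectX (pt a b) = pt (-a) b :=
  plane_ext (by simp [reflectX]) (by simp [reflectX])

lemma norm_reflectX (p : Plane) : ‖reflectX p‖ = ‖p‖ := by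
  simp [EuclideanSpace.norm_eq, Fin.sum_univ_two, reflectX]

lemma gweight_image_map_le {ρ : Plane →ₗ[ℝ] Plane} (hρ : ∀ p, ‖ρ p‖ = ‖p‖)
    (E : Finset (Plane × Plane)) : gweight (E.image (Prod.map ρ ρ)) ≤ gweight E :=
  (gweight_image_le _ _).trans (le_of_eq (by simp [gweight, ← map_sub, hρ]))

/-- The segment between nodes `a` and `b` lies below the curve. -/
def SeesBelow (N : ℕ) (σ : ℕ → ℝ) (x y : ℝ → ℝ) (b a : ℕ) : Prop :=
  ∀ τ ∈ Set.Icc (0 : ℝ) 1, ∃ r ∈ Set.Icc (σ 0) (σ N),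
    x r = x (σ b) + τ * (x (σ a) - x (σ b)) ∧ y (σ b) + τ * (y (σ a) - y (σ b)) ≤ y r

namespace IsTameCurve

variable {N : ℕ} {σ : ℕ → ℝ} {x y : ℝ → ℝ} {θ : ℝ}

/-- The curve traversed backwards and reflected in the vertical axis. -/
lemma reflect (h : IsTameCurve N σ x y) : IsTameCurve N (fun k => σ N - σ (N - k))
    (fun t => -x (σ N - t)) (fun t => y (σ N - t)) where
  mono := fun i j hij => by
    have := h.mono (show N - j ≤ N - i by omega)
    simp only
    linarith
  cont_x := (h.cont_x.comp (continuous_const.sub continuous_id)).neg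
  cont_y := h.cont_y.comp (continuous_const.sub continuous_id)
  edge := by
    intro i hi
    obtain ⟨j, hj⟩ : ∃ j, N = i + 1 + j := ⟨N - (i + 1), by omega⟩
    have e1 : N - i = j + 1 := by omega
    have e2 : N - (i + 1) = j := by omega
    simp only [e1, e2, sub_sub_cancel]
    have hr : ∀ t ∈ Set.Icc (σ N - σ (j + 1)) (σ N - σ j),
        σ N - t ∈ Set.Icc (σ j) (σ (j + 1)) := fun t ht =>
      ⟨by linarith [ht.2], by linarith [ht.1]⟩
    have hj1 : σ (j + 1) ∈ Set.Icc (σ j) (σ (j + 1)) := ⟨h.mono (Nat.le_succ j), le_rfl⟩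
    rcases h.edge j (by omega) with e | e | e
    · refine Or.inl fun t ht => ⟨?_, ?_⟩
      · linarith [(e _ (hr t ht)).1, (e _ hj1).1]
      · linarith [(e _ (hr t ht)).2, (e _ hj1).2]
    · refine Or.inr (Or.inr fun t ht => ⟨?_, ?_⟩)
      · linarith [(e _ (hr t ht)).1, (e _ hj1).1]
      · linarith [(e _ (hr t ht)).2, (e _ hj1).2]
    · refine Or.inr (Or.inl fun t ht => ⟨?_, ?_⟩)
      · linarith [(e _ (hr t ht)).1, (e _ hj1).1]
      · linarith [(e _ (hr t ht)).2, (e _ hj1).2]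
  tame := by
    intro s t hs hst ht hy hr
    simp only [Nat.sub_zero, sub_self, Nat.sub_self] at hs ht
    have := h.tame (σ N - t) (σ N - s) (by linarith) (by linarith) (by linarith) hy.symm
      fun r hr' => by
        have := hr (σ N - r) ⟨by linarith [hr'.2], by linarith [hr'.1]⟩
        simp only [sub_sub_cancel] at this
        linarith
    linarith
  inj := by
    intro s t hs hst ht hx hy
    simp only [Nat.sub_zero, sub_self, Nat.sub_self] at hs ht
    have := h.inj (σ N - t) (σ N - s) (by linarith) (by linarith) (by linarith)
      (by linarith) hy.symm
    linarith

lemma inCone_of_seesBelow (h : IsTameCurve N σ x y) (hθ : 0 < θ) {b a : ℕ} (hba : b ≤ a)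
    (haN : a ≤ N) (hy : y (σ b) ≤ y (σ a)) (hslope : x (σ a) - x (σ b) ≤ θ * (y (σ a) - y (σ b)))
    (hvis : SeesBelow N σ x y b a) : InCone σ x y θ b a := by
  have hb0 := (h.node_mem (hba.trans haN)).1
  have haN' := h.mono haN
  have hab := h.mono hba
  rcases (h.x_le hb0 hab haN').eq_or_lt with hx | hx
  · intro r hr
    have h1 := h.x_le hb0 hr.1 (hr.2.trans haN')
    have h2 := h.x_le (hb0.trans hr.1) hr.2 haN'
    have hxr : x r = x (σ b) := by linarith
    rw [hxr, sub_self]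
    refine mul_nonneg hθ.le (sub_nonneg.2 ?_)
    by_contra hlt
    push Not at hlt
    obtain ⟨r', hr', hyr'⟩ := intermediate_value_Icc hr.2 h.cont_y.continuousOn ⟨hlt.le, hy⟩
    have h3 := h.x_le (hb0.trans hr.1) hr'.1 (hr'.2.trans haN')
    have h4 := h.x_le (hb0.trans (hr.1.trans hr'.1)) hr'.2 haN'
    have h5 := h.inj (σ b) r' hb0 (hr.1.trans hr'.1) (hr'.2.trans haN') (by linarith) hyr'.symm
    have h6 : r = σ b := le_antisymm (by linarith [hr'.1]) hr.1
    rw [h6] at hlt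
    exact lt_irrefl _ hlt
  have hdx : 0 < x (σ a) - x (σ b) := by linarith
  have hdy : 0 < y (σ a) - y (σ b) := pos_of_mul_pos_right (hdx.trans_le hslope) hθ.le
  obtain ⟨g, hg⟩ : ∃ g : ℝ → ℝ, ∀ r, g r = (y (σ a) - y (σ b)) * (x r - x (σ b)) -
    (y r - y (σ b)) * (x (σ a) - x (σ b)) := ⟨_, fun _ => rfl⟩
  have hgc : Continuous g := by
    have : g = fun r => (y (σ a) - y (σ b)) * (x r - x (σ b)) -
      (y r - y (σ b)) * (x (σ a) - x (σ b)) := funext hg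
    rw [this]
    have := h.cont_x
    have := h.cont_y
    fun_prop
  have hgb : g (σ b) = 0 := by rw [hg]; ring
  have hga : g (σ a) = 0 := by rw [hg]; ring
  have key : ∀ r ∈ Set.Icc (σ b) (σ a), g r ≤ 0 := by
    intro r hr
    by_contra hpos
    push Not at hpos
    obtain ⟨α, hα, hgα, hα'⟩ := exists_last_crossing_lt hgc hr.1 hgb.le hpos.le
    obtain ⟨β, hβ, hgβ, hβ'⟩ := exists_first_crossing_lt hgc hr.2 hpos.le hga.le
    have hα0 : σ 0 ≤ α := hb0.trans hα.1
    have hβN : β ≤ σ N := hβ.2.trans haN'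
    have hαβ : α ≤ β := hα.2.trans hβ.1
    have hin : ∀ q ∈ Set.Ioo α β, 0 < g q := fun q hq => by
      rcases le_total q r with hqr | hqr
      · exact hα' q ⟨hq.1, hqr⟩
      · exact hβ' q ⟨hqr, hq.2⟩
    rw [hg] at hgα hgβ
    rcases (h.x_le hα0 hαβ hβN).eq_or_lt with hxx | hxx
    · have hyy : y α = y β := by
        rw [hxx] at hgα
        have : (y α - y (σ b)) * (x (σ a) - x (σ b)) = (y β - y (σ b)) * (x (σ a) - x (σ b)) := by
          linarith
        have := mul_right_cancel₀ hdx.ne' this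
        linarith
      have hE := h.inj α β hα0 hαβ hβN hxx hyy
      have : r = α := le_antisymm (by linarith [hβ.1]) hα.2
      rw [this, hg, hgα] at hpos
      exact lt_irrefl _ hpos
    · have hxα := h.x_le hb0 hα.1 (hαβ.trans hβN)
      have hxβ := h.x_le (hα0.trans hαβ) hβ.2 haN'
      obtain ⟨q, hq, hxq, hyq⟩ := hvis (((x α + x β) / 2 - x (σ b)) / (x (σ a) - x (σ b)))
        ⟨div_nonneg (by linarith) hdx.le, (div_le_one hdx).2 (by linarith)⟩
      rw [div_mul_cancel₀ _ hdx.ne'] at hxq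
      have hq1 : α < q := by
        by_contra hcon
        push Not at hcon
        linarith [h.x_le hq.1 hcon (hαβ.trans hβN)]
      have hq2 : q < β := by
        by_contra hcon
        push Not at hcon
        linarith [h.x_le (hα0.trans hαβ) hcon hq.2]
      have h1 := hin q ⟨hq1, hq2⟩
      rw [hg] at h1
      have h2 : ((x α + x β) / 2 - x (σ b)) / (x (σ a) - x (σ b)) * (y (σ a) - y (σ b)) ≤
        y q - y (σ b) := by linarith
      rw [div_mul_eq_mul_div, div_le_iff₀ hdx] at h2
      rw [hxq] at h1
      linarith
  intro r hr
  have h1 := key r hr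
  rw [hg] at h1
  have h2 := h.x_le hb0 hr.1 (hr.2.trans haN')
  have h3 : 0 ≤ y r - y (σ b) := by
    have : 0 ≤ (y r - y (σ b)) * (x (σ a) - x (σ b)) := by
      have := mul_nonneg hdy.le (sub_nonneg.2 h2)
      linarith
    exact nonneg_of_mul_nonneg_left this hdx
  have h4 := mul_le_mul_of_nonneg_left hslope h3
  have : (y (σ a) - y (σ b)) * (x r - x (σ b)) ≤
      (y (σ a) - y (σ b)) * (θ * (y r - y (σ b))) := by linarith
  exact le_of_mul_le_mul_left this hdy

/-- A graph joining all steep pairs of nodes that see each other below the curve. -/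
lemma exists_visible_spanner (h : IsTameCurve N σ x y) (hθ0 : 0 < θ) (hθ1 : θ ≤ 1) :
    ∃ E, gweight E ≤ 480014 * ((σ N - σ 0) / θ) ∧
      ∀ b a, b ≤ N → a ≤ N → y (σ b) ≤ y (σ a) →
        |x (σ a) - x (σ b)| ≤ θ * (y (σ a) - y (σ b)) → SeesBelow N σ x y b a →
        HasPath E (pt (x (σ b)) (y (σ b))) (pt (x (σ a)) (y (σ a)))
          ((1 + 200 * θ ^ 2) * (y (σ a) - y (σ b))) := by
  obtain ⟨E, hE1, hE2⟩ := h.exists_cone_spanner hθ0 hθ1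
  obtain ⟨F, hF1, hF2⟩ := h.reflect.exists_cone_spanner hθ0 hθ1
  refine ⟨E ∪ F.image (Prod.map reflectX reflectX), ?_, ?_⟩
  · have h1 := gweight_union_le E (F.image (Prod.map reflectX reflectX))
    have h2 := gweight_image_map_le norm_reflectX F
    simp only [Nat.sub_self, Nat.sub_zero, sub_self, sub_zero] at hF1
    linarith
  intro b a hb ha hy hslope hvis
  rcases le_total b a with hba | hba
  · exact (hE2 b a hba ha (h.inCone_of_seesBelow hθ0 hba ha hy ((le_abs_self _).trans hslope)
      hvis)).mono Finset.subset_union_left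
  · have hb' : N - (N - b) = b := by omega
    have ha' : N - (N - a) = a := by omega
    have hcone := h.reflect.inCone_of_seesBelow hθ0 (b := N - b) (a := N - a) (by omega)
      (by omega) (by simpa [hb', ha'] using hy)
      (by simp only [hb', ha', sub_sub_cancel]; linarith [neg_abs_le (x (σ a) - x (σ b))]) (by
        intro τ hτ
        obtain ⟨r, hr, hxr, hyr⟩ := hvis τ hτ
        refine ⟨σ N - r, ?_, ?_, ?_⟩
        · simp only [Nat.sub_self, Nat.sub_zero, sub_self]
          exact ⟨by linarith [hr.2], by linarith [hr.1]⟩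
        · simp only [hb', ha', sub_sub_cancel]
          linarith
        · simpa [hb', ha'] using hyr)
    have := (hF2 (N - b) (N - a) (by omega) (by omega) hcone).map reflectX norm_reflectX
    simp only [hb', ha', sub_sub_cancel, reflectX_pt, neg_neg] at this
    exact this.mono Finset.subset_union_right

end IsTameCurve

/-! ### Arc length parametrization of a polygonal path -/

/-- The length of the first `i` edges of a polygonal path. -/
def arcLen (u : ℕ → Plane) (i : ℕ) : ℝ := ∑ k ∈ Finset.range i, ‖u (k + 1) - u k‖

/-- The parametrization by arc length of the polygonal path with vertices `u 0, …, u n`. -/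
def arcPoint (n : ℕ) (u : ℕ → Plane) (t : ℝ) : Plane :=
  u 0 + ∑ i ∈ Finset.range n, min (max (t - arcLen u i) 0) ‖u (i + 1) - u i‖ •
    (‖u (i + 1) - u i‖⁻¹ • (u (i + 1) - u i))

section ArcPoint

variable {n : ℕ} {u : ℕ → Plane}

lemma arcLen_succ (i : ℕ) : arcLen u (i + 1) = arcLen u i + ‖u (i + 1) - u i‖ := by
  simp [arcLen, Finset.sum_range_succ]

lemma monotone_arcLen : Monotone (arcLen u) :=
  monotone_nat_of_le_succ fun i => by rw [arcLen_succ]; linarith [norm_nonneg (u (i + 1) - u i)]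

lemma norm_smul_inv_norm_smul (v : Plane) : ‖v‖ • (‖v‖⁻¹ • v) = v := by
  rcases eq_or_ne v 0 with rfl | hv
  · simp
  · rw [smul_smul, mul_inv_cancel₀ (norm_ne_zero_iff.2 hv), one_smul]

lemma continuous_arcPoint : Continuous (arcPoint n u) := by
  unfold arcPoint
  fun_prop

/-- The parametrization on the `i`-th edge. -/
lemma arcPoint_eq {i : ℕ} (hi : i < n) {t : ℝ}
    (ht : t ∈ Set.Icc (arcLen u i) (arcLen u (i + 1))) :
    arcPoint n u t = u i + (t - arcLen u i) • (‖u (i + 1) - u i‖⁻¹ • (u (i + 1) - u i)) := by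
  have hsub : Finset.range (i + 1) ⊆ Finset.range n := Finset.range_subset_range.2 hi
  unfold arcPoint
  rw [← Finset.sum_subset hsub, Finset.sum_range_succ]
  · have h1 : ∑ k ∈ Finset.range i, min (max (t - arcLen u k) 0) ‖u (k + 1) - u k‖ •
        (‖u (k + 1) - u k‖⁻¹ • (u (k + 1) - u k)) = u i - u 0 := by
      rw [← Finset.sum_range_sub u i]
      refine Finset.sum_congr rfl fun k hk => ?_
      have hk1 : arcLen u (k + 1) ≤ arcLen u i := monotone_arcLen (Finset.mem_range.1 hk)
      rw [arcLen_succ] at hk1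
      rw [min_eq_right, norm_smul_inv_norm_smul]
      exact le_max_of_le_left (by linarith [ht.1])
    have h2 := ht.2
    rw [arcLen_succ] at h2
    rw [h1, max_eq_left (by linarith [ht.1]), min_eq_left (by linarith)]
    abel
  · intro k _ hk
    rw [Finset.mem_range, not_lt] at hk
    have hk1 : arcLen u (i + 1) ≤ arcLen u k := monotone_arcLen hk
    rw [max_eq_right (by linarith [ht.2]), min_eq_left (norm_nonneg _), zero_smul]

lemma exists_arcPoint_eq {i : ℕ} (hi : i < n) {z : Plane}
    (hz : z ∈ segment ℝ (u i) (u (i + 1))) :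
    ∃ t ∈ Set.Icc (arcLen u i) (arcLen u (i + 1)), arcPoint n u t = z := by
  rw [segment_eq_image'] at hz
  obtain ⟨τ, hτ, rfl⟩ := hz
  have hm : arcLen u i + τ * ‖u (i + 1) - u i‖ ∈ Set.Icc (arcLen u i) (arcLen u (i + 1)) := by
    rw [arcLen_succ]
    refine ⟨?_, ?_⟩
    · linarith [mul_nonneg hτ.1 (norm_nonneg (u (i + 1) - u i))]
    · linarith [mul_le_mul_of_nonneg_right hτ.2 (norm_nonneg (u (i + 1) - u i))]
  refine ⟨_, hm, ?_⟩
  rw [arcPoint_eq hi hm, add_sub_cancel_left, mul_smul, norm_smul_inv_norm_smul]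

lemma arcPoint_mem_segment {i : ℕ} (hi : i < n) {t : ℝ}
    (ht : t ∈ Set.Icc (arcLen u i) (arcLen u (i + 1))) :
    arcPoint n u t ∈ segment ℝ (u i) (u (i + 1)) := by
  rw [arcPoint_eq hi ht, segment_eq_image']
  have h2 := ht.2
  rw [arcLen_succ] at h2
  refine ⟨(t - arcLen u i) * ‖u (i + 1) - u i‖⁻¹, ⟨?_, ?_⟩, by simp only [mul_smul]⟩
  · exact mul_nonneg (by linarith [ht.1]) (by positivity)
  · exact div_le_one_of_le₀ (by linarith) (norm_nonneg _)

lemma norm_arcPoint_sub {i : ℕ} (hi : i < n) {s t : ℝ}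
    (hs : s ∈ Set.Icc (arcLen u i) (arcLen u (i + 1)))
    (ht : t ∈ Set.Icc (arcLen u i) (arcLen u (i + 1))) (hst : s ≤ t) :
    ‖arcPoint n u t - arcPoint n u s‖ = t - s := by
  rw [arcPoint_eq hi hs, arcPoint_eq hi ht, add_sub_add_left_eq_sub, ← sub_smul, norm_smul,
    norm_smul, norm_inv, norm_norm, sub_sub_sub_cancel_right, Real.norm_of_nonneg (by linarith)]
  rcases (norm_nonneg (u (i + 1) - u i)).eq_or_lt with h0 | h0
  · have h1 := hs.1
    have h2 := ht.2
    rw [arcLen_succ] at h2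
    have : t - s = 0 := by linarith
    rw [this, zero_mul]
  · rw [inv_mul_cancel₀ h0.ne', mul_one]

lemma arcPoint_arcLen_left {i : ℕ} (hi : i < n) : arcPoint n u (arcLen u i) = u i := by
  rw [arcPoint_eq hi ⟨le_rfl, monotone_arcLen (Nat.le_succ i)⟩]
  simp

lemma arcPoint_arcLen_right {i : ℕ} (hi : i < n) :
    arcPoint n u (arcLen u (i + 1)) = u (i + 1) := by
  rw [arcPoint_eq hi ⟨monotone_arcLen (Nat.le_succ i), le_rfl⟩, arcLen_succ, add_sub_cancel_left,
    norm_smul_inv_norm_smul, add_sub_cancel]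

lemma subLen_arcPoint {i j : ℕ} (hij : i ≤ j) (hj : j < n) {s t : ℝ}
    (hs : s ∈ Set.Icc (arcLen u i) (arcLen u (i + 1)))
    (ht : t ∈ Set.Icc (arcLen u j) (arcLen u (j + 1))) (hst : s ≤ t) :
    subLen u i j (arcPoint n u s) (arcPoint n u t) = t - s := by
  unfold subLen
  split_ifs with h
  · subst h
    exact norm_arcPoint_sub hj hs ht hst
  · have hi : i < n := hij.trans_lt hj
    have h1 := norm_arcPoint_sub hi hs ⟨monotone_arcLen (Nat.le_succ i), le_rfl⟩ hs.2
    have h2 := norm_arcPoint_sub hj ⟨le_rfl, monotone_arcLen (Nat.le_succ j)⟩ ht ht.1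
    rw [arcPoint_arcLen_right hi] at h1
    rw [arcPoint_arcLen_left hj] at h2
    rw [h1, h2, Finset.sum_Ico_eq_sub _ (show i + 1 ≤ j by omega)]
    simp only [arcLen]
    ring

lemma mem_pathSet_iff {z : Plane} :
    z ∈ pathSet n u ↔ ∃ i < n, z ∈ segment ℝ (u i) (u (i + 1)) := by
  simp [pathSet]

lemma exists_arcPoint_eq_of_mem_pathSet {z : Plane} (hz : z ∈ pathSet n u) :
    ∃ t ∈ Set.Icc (arcLen u 0) (arcLen u n), arcPoint n u t = z := by
  obtain ⟨i, hi, hz⟩ := mem_pathSet_iff.1 hz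
  obtain ⟨t, ht, rfl⟩ := exists_arcPoint_eq hi hz
  exact ⟨t, ⟨(monotone_arcLen (Nat.zero_le i)).trans ht.1, ht.2.trans (monotone_arcLen hi)⟩, rfl⟩

lemma arcPoint_mem_pathSet (hn : 0 < n) {t : ℝ}
    (ht : t ∈ Set.Icc (arcLen u 0) (arcLen u n)) : arcPoint n u t ∈ pathSet n u := by
  obtain ⟨i, _, hi, hti⟩ := exists_edge_of_mem_Icc hn ht.1 ht.2
  exact mem_pathSet_iff.2 ⟨i, hi, arcPoint_mem_segment hi hti⟩

end ArcPoint

namespace IsTamePath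

variable {n : ℕ} {u : ℕ → Plane}

/-- The edges of a tame path move right, up or down. -/
lemma arcPoint_edge (h : IsTamePath n u) {i : ℕ} (hi : i < n) :
    (∀ t ∈ Set.Icc (arcLen u i) (arcLen u (i + 1)),
      arcPoint n u t 0 = u i 0 + (t - arcLen u i) ∧ arcPoint n u t 1 = u i 1) ∨
    (∀ t ∈ Set.Icc (arcLen u i) (arcLen u (i + 1)),
      arcPoint n u t 0 = u i 0 ∧ arcPoint n u t 1 = u i 1 + (t - arcLen u i)) ∨
    (∀ t ∈ Set.Icc (arcLen u i) (arcLen u (i + 1)),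
      arcPoint n u t 0 = u i 0 ∧ arcPoint n u t 1 = u i 1 - (t - arcLen u i)) := by
  rcases (norm_nonneg (u (i + 1) - u i)).eq_or_lt with h0 | h0
  · refine Or.inl fun t ht => ?_
    have h1 := ht.1
    have h2 := ht.2
    rw [arcLen_succ] at h2
    have : t - arcLen u i = 0 := by linarith
    rw [arcPoint_eq hi ht, this]
    simp
  rcases h.1 i hi with hv | hv
  · have hnorm : ‖u (i + 1) - u i‖ = |u (i + 1) 1 - u i 1| := norm_sub_of_fst_eq hv.symm
    rw [hnorm] at h0
    rcases le_total 0 (u (i + 1) 1 - u i 1) with hs | hs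
    · rw [abs_of_nonneg hs] at hnorm h0
      refine Or.inr (Or.inl fun t ht => ?_)
      rw [arcPoint_eq hi ht, hnorm]
      simp [hv, inv_mul_cancel₀ h0.ne']
    · rw [abs_of_nonpos hs] at hnorm h0
      refine Or.inr (Or.inr fun t ht => ?_)
      rw [arcPoint_eq hi ht, hnorm]
      have e : (-(u (i + 1) 1 - u i 1))⁻¹ * (u (i + 1) 1 - u i 1) = -1 := by
        rw [inv_mul_eq_iff_eq_mul₀ h0.ne']
        ring
      simp only [PiLp.add_apply, PiLp.smul_apply, PiLp.sub_apply, smul_eq_mul, e, hv]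
      constructor <;> ring
  · have hs := sub_nonneg.2 (h.2.1 i hi)
    have hnorm : ‖u (i + 1) - u i‖ = u (i + 1) 0 - u i 0 := by
      rw [norm_sub_of_snd_eq hv.symm, abs_of_nonneg hs]
    rw [hnorm] at h0
    refine Or.inl fun t ht => ?_
    rw [arcPoint_eq hi ht, hnorm]
    simp [hv, inv_mul_cancel₀ h0.ne']

lemma sub_le_of_segment_subset (h : IsTamePath n u) (hn : 0 < n) {s t : ℝ}
    (hs : arcLen u 0 ≤ s) (hst : s ≤ t) (ht : t ≤ arcLen u n)
    (hy : arcPoint n u s 1 = arcPoint n u t 1)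
    (hsub : segment ℝ (arcPoint n u s) (arcPoint n u t) ⊆ belowRegion (pathSet n u)) :
    t - s ≤ 2 * ‖arcPoint n u s - arcPoint n u t‖ := by
  obtain ⟨i, _, hi, hsi⟩ := exists_edge_of_mem_Icc hn hs (hst.trans ht)
  obtain ⟨j, hij, hj, htj⟩ : ∃ j, i ≤ j ∧ j < n ∧
      t ∈ Set.Icc (arcLen u j) (arcLen u (j + 1)) := exists_edge_of_mem_Icc hi (hsi.1.trans hst) ht
  rw [← subLen_arcPoint hij hj hsi htj hst]
  exact h.2.2 i j _ _ hij hj (arcPoint_mem_segment hi hsi) (arcPoint_mem_segment hj htj) hy hsub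

/-- A tame path with additional nodes is a tame curve. -/
lemma isTameCurve (h : IsTamePath n u) (hn : 0 < n) {N : ℕ} {σ : ℕ → ℝ} (hσ : Monotone σ)
    (h0 : σ 0 = arcLen u 0) (hN : σ N = arcLen u n)
    (hedge : ∀ i < N, ∃ k < n, arcLen u k ≤ σ i ∧ σ (i + 1) ≤ arcLen u (k + 1)) :
    IsTameCurve N σ (fun t => arcPoint n u t 0) (fun t => arcPoint n u t 1) := by
  have hcont : ∀ c : Fin 2, Continuous fun t => arcPoint n u t c := fun c => by
    have := continuous_arcPoint (n := n) (u := u)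
    fun_prop
  have hmono : MonotoneOn (fun t => arcPoint n u t 0) (Set.Icc (arcLen u 0) (arcLen u n)) := by
    refine monotoneOn_of_monotoneOn_edges monotone_arcLen n fun i hi a ha b hb hab => ?_
    rcases h.arcPoint_edge hi with e | e | e <;> linarith [(e a ha).1, (e b hb).1]
  refine ⟨hσ, hcont 0, hcont 1, ?_, ?_, ?_⟩
  · intro i hi
    obtain ⟨k, hk, h1, h2⟩ := hedge i hi
    have hm : ∀ t ∈ Set.Icc (σ i) (σ (i + 1)), t ∈ Set.Icc (arcLen u k) (arcLen u (k + 1)) :=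
      fun t ht => ⟨h1.trans ht.1, ht.2.trans h2⟩
    have hmi := hm (σ i) ⟨le_rfl, hσ (Nat.le_succ i)⟩
    rcases h.arcPoint_edge hk with e | e | e
    · refine Or.inl fun t ht => ⟨?_, ?_⟩
      · linarith [(e t (hm t ht)).1, (e _ hmi).1]
      · linarith [(e t (hm t ht)).2, (e _ hmi).2]
    · refine Or.inr (Or.inl fun t ht => ⟨?_, ?_⟩)
      · linarith [(e t (hm t ht)).1, (e _ hmi).1]
      · linarith [(e t (hm t ht)).2, (e _ hmi).2]
    · refine Or.inr (Or.inr fun t ht => ⟨?_, ?_⟩)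
      · linarith [(e t (hm t ht)).1, (e _ hmi).1]
      · linarith [(e t (hm t ht)).2, (e _ hmi).2]
  · intro s t hs hst ht hy hr
    rw [h0] at hs
    rw [hN] at ht
    have hx := hmono ⟨hs, hst.trans ht⟩ ⟨hs.trans hst, ht⟩ hst
    simp only at hx
    have hmem : ∀ r ∈ Set.Icc s t, arcPoint n u r ∈ pathSet n u := fun r hr =>
      arcPoint_mem_pathSet hn ⟨hs.trans hr.1, hr.2.trans ht⟩
    have := h.sub_le_of_segment_subset hn hs hst ht hy fun p hp => by
      rw [segment_eq_image'] at hp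
      obtain ⟨τ, hτ, rfl⟩ := hp
      have hy' : (arcPoint n u s + τ • (arcPoint n u t - arcPoint n u s)) 1 =
          arcPoint n u s 1 := by simp [hy]
      obtain ⟨r, hr1, hr2⟩ := intermediate_value_Icc hst (hcont 0).continuousOn
        (show (arcPoint n u s + τ • (arcPoint n u t - arcPoint n u s)) 0 ∈ _ from by
          simp only [PiLp.add_apply, PiLp.smul_apply, PiLp.sub_apply, smul_eq_mul]
          constructor
          · nlinarith [mul_nonneg hτ.1 (sub_nonneg.2 hx)]
          · nlinarith [mul_le_mul_of_nonneg_right hτ.2 (sub_nonneg.2 hx)])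
      refine ⟨⟨_, hmem r hr1, hr2, ?_⟩, ⟨_, hmem s ⟨le_rfl, hst⟩, hy'.ge⟩⟩
      rw [hy']
      exact hr r hr1
    rwa [norm_sub_rev, norm_sub_of_snd_eq hy.symm, abs_of_nonneg (sub_nonneg.2 hx)] at this
  · intro s t hs hst ht hx hy
    rw [h0] at hs
    rw [hN] at ht
    have hp : arcPoint n u s = arcPoint n u t := plane_ext hx hy
    have := h.sub_le_of_segment_subset hn hs hst ht hy (by
      rw [← hp, segment_same, Set.singleton_subset_iff]
      have hm : arcPoint n u s ∈ pathSet n u := arcPoint_mem_pathSet hn ⟨hs, hst.trans ht⟩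
      exact ⟨⟨_, hm, rfl, le_rfl⟩, ⟨_, hm, le_rfl⟩⟩)
    rw [hp, sub_self, norm_zero] at this
    linarith

end IsTamePath

/-- A finite set of reals enumerated in increasing order. -/
lemma exists_monotone_enumeration {T : Finset ℝ} (hT : T.Nonempty) :
    ∃ (N : ℕ) (σ : ℕ → ℝ), Monotone σ ∧ (∀ k, σ k ∈ T) ∧ (∀ t ∈ T, ∃ k ≤ N, σ k = t) ∧
      ∀ i < N, σ i < σ (i + 1) ∧ ∀ t ∈ T, t ≤ σ i ∨ σ (i + 1) ≤ t := by
  have hc : 0 < T.card := hT.card_pos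
  obtain ⟨σ, hσ⟩ : ∃ σ : ℕ → ℝ, ∀ k, σ k = T.orderEmbOfFin rfl
    ⟨min k (T.card - 1), by omega⟩ := ⟨_, fun _ => rfl⟩
  have hmono : Monotone σ := fun i j hij => by
    rw [hσ, hσ]
    exact (T.orderEmbOfFin rfl).monotone (by simp only [Fin.mk_le_mk]; omega)
  have hex : ∀ t ∈ T, ∃ k ≤ T.card - 1, σ k = t := by
    intro t ht
    have : t ∈ Set.range (T.orderEmbOfFin rfl) := by
      rw [Finset.range_orderEmbOfFin]
      exact ht
    obtain ⟨k, rfl⟩ := this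
    refine ⟨k, by omega, ?_⟩
    rw [hσ]
    congr 1
    ext
    simp only
    omega
  refine ⟨T.card - 1, σ, hmono, fun k => by rw [hσ]; exact Finset.orderEmbOfFin_mem _ _ _, hex, ?_⟩
  refine fun i hi => ⟨?_, fun t ht => ?_⟩
  · rw [hσ, hσ]
    exact (T.orderEmbOfFin rfl).strictMono (by simp only [Fin.mk_lt_mk]; omega)
  · obtain ⟨k, hk, rfl⟩ := hex t ht
    rcases Nat.lt_or_ge i k with h | h
    · exact Or.inr (hmono h)
    · exact Or.inl (hmono h)

/-- A tame path admits a refinement of its vertices whose nodes include prescribed points. -/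
lemma IsTamePath.exists_isTameCurve {n : ℕ} {u : ℕ → Plane} (h : IsTamePath n u) (hn : 0 < n)
    (S : Finset Plane) (hS : ↑S ⊆ pathSet n u) :
    ∃ (N : ℕ) (σ : ℕ → ℝ),
      IsTameCurve N σ (fun t => arcPoint n u t 0) (fun t => arcPoint n u t 1) ∧
      σ 0 = arcLen u 0 ∧ σ N = arcLen u n ∧ ∀ z ∈ S, ∃ k ≤ N, arcPoint n u (σ k) = z := by
  have hex : ∀ z, ∃ t, z ∈ S → t ∈ Set.Icc (arcLen u 0) (arcLen u n) ∧ arcPoint n u t = z := by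
    intro z
    by_cases hz : z ∈ S
    · obtain ⟨t, h1, h2⟩ := exists_arcPoint_eq_of_mem_pathSet (hS hz)
      exact ⟨t, fun _ => ⟨h1, h2⟩⟩
    · exact ⟨0, fun h => absurd h hz⟩
  choose p hp using hex
  obtain ⟨T, hT⟩ : ∃ T, T = (Finset.range (n + 1)).image (arcLen u) ∪ S.image p := ⟨_, rfl⟩
  have hA : ∀ k ≤ n, arcLen u k ∈ T := fun k hk => hT ▸ Finset.mem_union_left _
    (Finset.mem_image_of_mem _ (Finset.mem_range.2 (by omega)))
  have hTr : ∀ t ∈ T, t ∈ Set.Icc (arcLen u 0) (arcLen u n) := by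
    intro t ht
    rw [hT, Finset.mem_union, Finset.mem_image, Finset.mem_image] at ht
    rcases ht with ⟨k, hk, rfl⟩ | ⟨z, hz, rfl⟩
    · exact ⟨monotone_arcLen (Nat.zero_le k),
        monotone_arcLen (Nat.lt_succ_iff.1 (Finset.mem_range.1 hk))⟩
    · exact (hp z hz).1
  obtain ⟨N, σ, hσ, hmem, hsurj, hgap⟩ := exists_monotone_enumeration ⟨_, hA 0 (Nat.zero_le n)⟩
  have h0 : σ 0 = arcLen u 0 := by
    obtain ⟨k, _, hk⟩ := hsurj _ (hA 0 (Nat.zero_le n))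
    exact le_antisymm (hk ▸ hσ (Nat.zero_le k)) (hTr _ (hmem 0)).1
  have hN : σ N = arcLen u n := by
    obtain ⟨k, hkN, hk⟩ := hsurj _ (hA n le_rfl)
    exact le_antisymm (hTr _ (hmem N)).2 (hk ▸ hσ hkN)
  refine ⟨N, σ, h.isTameCurve hn hσ h0 hN ?_, h0, hN, ?_⟩
  · intro i hi
    obtain ⟨hlt, hg⟩ := hgap i hi
    have hn' : σ i < arcLen u n := hlt.trans_le (hTr _ (hmem _)).2
    have hfind : ∃ k, σ i < arcLen u k := ⟨n, hn'⟩
    have h1 := Nat.find_spec hfind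
    have hkn : Nat.find hfind ≤ n := Nat.find_min' hfind hn'
    have hpos : 0 < Nat.find hfind := by
      rw [Nat.find_pos]
      exact not_lt.2 (hTr _ (hmem i)).1
    refine ⟨Nat.find hfind - 1, by omega, ?_, ?_⟩
    · exact not_lt.1 (Nat.find_min hfind (by omega))
    · rw [Nat.sub_add_cancel hpos]
      rcases hg _ (hA _ hkn) with h2 | h2
      · linarith
      · exact h2
  · intro z hz
    obtain ⟨k, hk, hkz⟩ := hsurj (p z) (hT ▸ Finset.mem_union_right _ (Finset.mem_image_of_mem _ hz))
    exact ⟨k, hk, by rw [hkz]; exact (hp z hz).2⟩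

-- **Statement 19.** (Directional spanners for tame histograms.) There is an absolute
-- constant `C > 0` such that for every `ε ∈ (0,1]`, every tame histogram `H` (bounded
-- below by a horizontal segment `pq` and above by a tame path `L` from `p` to `q` lying
-- on or above the line through `p` and `q`), and every finite set `S` of points on the
-- boundary of `H`, there is a geometric graph of total weight at most
-- `C·ε^{-1/2}·hper(H)` containing, for all `a, b ∈ S` such that `ab ⊆ H` and
-- `|x(a) − x(b)| ≤ ε^{1/2}·|y(a) − y(b)|`, an `ab`-path of weight at most
-- `(1 + C·ε)·‖a − b‖`.
theorem directional_spanner_tame_histogram :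
    ∃ C : ℝ, 0 < C ∧
      ∀ ε : ℝ, 0 < ε → ε ≤ 1 →
      ∀ (n : ℕ) (u : ℕ → Plane), IsTamePath n u →
        u 0 1 = u n 1 →
        (∀ z ∈ pathSet n u, u 0 1 ≤ z 1) →
        ∀ S : Finset Plane, ↑S ⊆ pathSet n u ∪ segment ℝ (u 0) (u n) →
          ∃ E : Finset (Plane × Plane),
            gweight E ≤ C * (Real.sqrt ε)⁻¹ * (hper n u + ‖u 0 - u n‖) ∧
            ∀ a ∈ S, ∀ b ∈ S,
              segment ℝ a b ⊆ histRegion n u →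
              |a 0 - b 0| ≤ Real.sqrt ε * |a 1 - b 1| →
              HasPath E a b ((1 + C * ε) * ‖a - b‖) := by
  refine ⟨960210, by norm_num, fun ε hε0 hε1 n u h hbase habove S hS => ?_⟩
  obtain ⟨θ, hθ⟩ : ∃ θ, θ = Real.sqrt ε := ⟨_, rfl⟩
  have hθ0 : 0 < θ := hθ ▸ Real.sqrt_pos.2 hε0
  have hθ1 : θ ≤ 1 := hθ ▸ Real.sqrt_le_one.2 hε1
  have hθε : θ ^ 2 = ε := by rw [hθ, Real.sq_sqrt hε0.le]
  rw [← hθ]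
  have hper0 : 0 ≤ hper n u := Finset.sum_nonneg fun _ _ => abs_nonneg _
  rcases Nat.eq_zero_or_pos n with rfl | hn
  · refine ⟨∅, ?_, fun a _ b _ hab _ => ?_⟩
    · rw [gweight, Finset.sum_empty]
      positivity
    · obtain ⟨_, _, _, q, hq, _⟩ := hab (left_mem_segment ℝ a b)
      simp [pathSet] at hq
  obtain ⟨N, σ, hc, h0, hN, hnode⟩ := h.exists_isTameCurve hn (S.filter (· ∈ pathSet n u))
    (fun z hz => (Finset.mem_filter.1 (Finset.mem_coe.1 hz)).2)
  have hu0 : arcPoint n u (σ 0) = u 0 := by rw [h0, arcPoint_arcLen_left hn]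
  have hun : arcPoint n u (σ N) = u n := by
    obtain ⟨m, rfl⟩ : ∃ m, n = m + 1 := ⟨n - 1, by omega⟩
    rw [hN, arcPoint_arcLen_right (Nat.lt_succ_self m)]
  have hlow : ∀ t ∈ Set.Icc (σ 0) (σ N), u 0 1 ≤ arcPoint n u t 1 := fun t ht =>
    habove _ (arcPoint_mem_pathSet hn (h0 ▸ hN ▸ ht))
  have hσN : σ 0 ≤ σ N := hc.mono (Nat.zero_le N)
  have hlen : σ N - σ 0 ≤ 2 * (hper n u + ‖u 0 - u n‖) := by
    have h1 := hc.tame (σ 0) (σ N) le_rfl hσN le_rfl (by simp only [hu0, hun, hbase])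
      (fun r hr => by simpa only [hu0] using hlow r hr)
    simp only [hu0, hun] at h1
    have h2 : u n 0 - u 0 0 ≤ ‖u 0 - u n‖ := by
      rw [norm_sub_rev, norm_sub_of_snd_eq hbase.symm]
      exact le_abs_self _
    linarith
  obtain ⟨EA, hEA1, hEA2⟩ := hc.exists_base_spanner hθ0 hθ1 (y₀ := u 0 1)
    (fun i hi => hlow _ (hc.node_mem hi)) (by simp only [hun, hbase])
  obtain ⟨EB, hEB1, hEB2⟩ := hc.exists_visible_spanner hθ0 hθ1
  have hC := hc.gweight_curveEdges_le
  refine ⟨(EA ∪ curveEdges N σ (fun t => arcPoint n u t 0) (fun t => arcPoint n u t 1)) ∪ EB,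
    ?_, ?_⟩
  · have h1 := gweight_union_le (EA ∪ curveEdges N σ (fun t => arcPoint n u t 0)
      (fun t => arcPoint n u t 1)) EB
    have h2 := gweight_union_le EA (curveEdges N σ (fun t => arcPoint n u t 0)
      (fun t => arcPoint n u t 1))
    have h3 : σ N - σ 0 ≤ (σ N - σ 0) / θ := by
      rw [le_div_iff₀ hθ0]
      exact mul_le_of_le_one_right (by linarith) hθ1
    have h4 : (σ N - σ 0) / θ ≤ 2 * (θ⁻¹ * (hper n u + ‖u 0 - u n‖)) := by
      rw [div_eq_inv_mul]
      have := mul_le_mul_of_nonneg_left hlen (inv_nonneg.2 hθ0.le)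
      linarith
    linarith
  have main : ∀ a ∈ S, ∀ b ∈ S, b 1 ≤ a 1 → segment ℝ b a ⊆ histRegion n u →
      |a 0 - b 0| ≤ θ * (a 1 - b 1) →
      HasPath ((EA ∪ curveEdges N σ (fun t => arcPoint n u t 0) (fun t => arcPoint n u t 1)) ∪ EB)
        b a ((1 + 960210 * ε) * ‖a - b‖) := by
    intro a ha b hb hba hseg hslope
    have hbelow : ∀ z ∈ segment ℝ (u 0) (u n), z = pt (z 0) (u 0 1) := by
      intro z hz
      rw [segment_eq_image'] at hz
      obtain ⟨τ, _, rfl⟩ := hz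
      exact plane_ext (by simp) (by simp [hbase])
    have hb1 : u 0 1 ≤ b 1 := by
      rcases hS hb with hb | hb
      · exact habove b hb
      · rw [hbelow b hb, pt_one]
    have hnorm : a 1 - b 1 ≤ ‖a - b‖ := (le_abs_self _).trans (abs_snd_sub_le_norm a b)
    have hweight : ∀ c : ℝ, 0 ≤ c → c ≤ 960210 →
        (1 + c * θ ^ 2) * (a 1 - b 1) ≤ (1 + 960210 * ε) * ‖a - b‖ := by
      intro c hc0 hc
      rw [hθε]
      gcongr
    rcases hba.eq_or_lt with heq | hlt
    · have hx : a 0 - b 0 = 0 := by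
        rw [heq, sub_self, mul_zero] at hslope
        exact abs_nonpos_iff.1 hslope
      have hab : a = b := plane_ext (by linarith) heq.symm
      rw [hab]
      exact (HasPath.refl _ b).mono_weight (by positivity)
    have haL : a ∈ pathSet n u := by
      rcases hS ha with ha | ha
      · exact ha
      · rw [hbelow a ha, pt_one] at hlt
        linarith
    obtain ⟨k, hk, hka⟩ := hnode a (Finset.mem_filter.2 ⟨ha, haL⟩)
    rcases hS hb with hbL | hbL
    · obtain ⟨l, hl, hlb⟩ := hnode b (Finset.mem_filter.2 ⟨hb, hbL⟩)
      have hpath := hEB2 l k hl hk (by simpa only [hka, hlb] using hba)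
        (by simpa only [hka, hlb] using hslope) (by
          intro τ hτ
          simp only [hka, hlb]
          obtain ⟨_, _, _, q, hq, hq0, hq1⟩ := hseg (show b + τ • (a - b) ∈ _ by
            rw [segment_eq_image']
            exact ⟨τ, hτ, rfl⟩)
          obtain ⟨r, hr, rfl⟩ := exists_arcPoint_eq_of_mem_pathSet hq
          refine ⟨r, by rwa [h0, hN], ?_, ?_⟩
          · simpa using hq0
          · simpa using hq1)
      simp only [hka, hlb, pt_eta] at hpath
      exact (hpath.mono Finset.subset_union_right).mono_weight
        (hweight 200 (by norm_num) (by norm_num))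
    · have hby : b 1 = u 0 1 := by rw [hbelow b hbL, pt_one]
      have hpath := hEA2 k hk (b 0) (by simpa only [hka, ← hby] using hslope)
      simp only [hka, ← hby, pt_eta] at hpath
      exact (hpath.mono Finset.subset_union_left).mono_weight
        (hweight 480 (by norm_num) (by norm_num))
  intro a ha b hb hseg hslope
  rcases le_total (b 1) (a 1) with hba | hba
  · rw [abs_of_nonneg (sub_nonneg.2 hba)] at hslope
    exact (main a ha b hb hba (segment_symm ℝ a b ▸ hseg) hslope).symm
  · rw [abs_of_nonpos (sub_nonpos.2 hba), neg_sub, abs_sub_comm] at hslope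
    rw [norm_sub_rev]
    exact main b hb a ha hba hseg hslope

end
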